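/- arXiv:2604.24632 — 2 statements merged into one kernel-verified Lean document; each statement's English description precedes it below -/
import Mathlib

section
/- Let X ∼ μ be a Borel probability measure on ℝ^d with E[X] = 0 and E‖X‖² < ∞, and let c₄ = (e⁴ − 5)/16. Then W₁(μ * γ, γ) ≤ (2 + √(2c₄)) · E‖X‖² ≤ 5 · E‖X‖². If additionally E‖X‖⁴ < ∞, then W₂(μ * γ, γ) ≤ (2 + √(2c₄)) · (E‖X‖⁴)^{1/2} ≤ 5 · (E‖X‖⁴)^{1/2}. -/
open MeasureTheory ProbabilityTheory Real ENNReal RealInnerProductSpace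

noncomputable section

/-- The set of couplings of two measures `μ` and `ν`. -/
def couplings {E : Type*} [MeasurableSpace E] (μ ν : Measure E) : Set (Measure (E × E)) :=
  {τ | τ.map Prod.fst = μ ∧ τ.map Prod.snd = ν}

/-- The Wasserstein-`p` distance, valued in `ℝ≥0∞`:
`W_p(μ,ν) = (inf over couplings τ of ∫ ‖z₁ - z₂‖^p dτ)^{1/p}`. -/
noncomputable def Wp {E : Type*} [MeasurableSpace E] [NormedAddCommGroup E]
    (p : ℝ) (μ ν : Measure E) : ℝ≥0∞ :=
  (⨅ τ ∈ couplings μ ν, ∫⁻ z : E × E, ENNReal.ofReal (‖z.1 - z.2‖ ^ p) ∂τ) ^ (1 / p)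

/-- The standard Gaussian measure `N(0, I_d)` on `ℝ^d`. -/
noncomputable def stdGaussian (d : ℕ) : Measure (EuclideanSpace ℝ (Fin d)) :=
  (Measure.pi fun _ : Fin d => gaussianReal 0 1).map
    ((EuclideanSpace.equiv (Fin d) ℝ).symm : (Fin d → ℝ) → EuclideanSpace ℝ (Fin d))

/-- The Gaussian measure `N(m, I_d)` on `ℝ^d`. -/
noncomputable def gaussianE (d : ℕ) (m : EuclideanSpace ℝ (Fin d)) :
    Measure (EuclideanSpace ℝ (Fin d)) :=
  (stdGaussian d).map (fun x => m + x)

/-- `C_p = (E_{ξ ∼ N(0,1)} |ξ|^p)^{1/p}`. -/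
noncomputable def Cconst (p : ℝ) : ℝ := (∫ ξ : ℝ, |ξ| ^ p ∂(gaussianReal 0 1)) ^ (1 / p)

/-- `K_p = max {1, C_p/2 + 1/3}`. -/
noncomputable def Kconst (p : ℝ) : ℝ := max 1 (Cconst p / 2 + 1 / 3)

/-- The constant `c₄ = (e⁴ - 5)/16`. -/
noncomputable def cFour : ℝ := (Real.exp 4 - 5) / 16

/-- The (second-moment) covariance matrix `∫ x xᵀ dμ` of a (centred) measure on `ℝ^d`. -/
noncomputable def covMat {d : ℕ} (μ : Measure (EuclideanSpace ℝ (Fin d))) :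
    Matrix (Fin d) (Fin d) ℝ :=
  Matrix.of fun i j => ∫ x, x i * x j ∂μ

/-- The Frobenius norm of a matrix. -/
noncomputable def frob {d : ℕ} (A : Matrix (Fin d) (Fin d) ℝ) : ℝ :=
  Real.sqrt (∑ i, ∑ j, (A i j) ^ 2)

/-- `τ₁ = E[‖X‖ 1_{‖X‖ > 1}]`. -/
noncomputable def tailOne {d : ℕ} (μ : Measure (EuclideanSpace ℝ (Fin d))) : ℝ :=
  ∫ x in {x : EuclideanSpace ℝ (Fin d) | 1 < ‖x‖}, ‖x‖ ∂μ

/-- `τ₂ = (E[‖X‖² 1_{‖X‖ > 1}])^{1/2}`. -/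
noncomputable def tailTwo {d : ℕ} (μ : Measure (EuclideanSpace ℝ (Fin d))) : ℝ :=
  Real.sqrt (∫ x in {x : EuclideanSpace ℝ (Fin d) | 1 < ‖x‖}, ‖x‖ ^ 2 ∂μ)

/-- `m = E[X 1_{‖X‖ ≤ 1}]`. -/
noncomputable def truncMean {d : ℕ} (μ : Measure (EuclideanSpace ℝ (Fin d))) :
    EuclideanSpace ℝ (Fin d) :=
  ∫ x in {x : EuclideanSpace ℝ (Fin d) | ‖x‖ ≤ 1}, x ∂μ

/-- `X̃ = X 1_{‖X‖ ≤ 1} - E[X 1_{‖X‖ ≤ 1}]`, as a function of `X`. -/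
noncomputable def truncCentred {d : ℕ} (μ : Measure (EuclideanSpace ℝ (Fin d)))
    (x : EuclideanSpace ℝ (Fin d)) : EuclideanSpace ℝ (Fin d) :=
  (if ‖x‖ ≤ 1 then x else 0) - truncMean μ

/-- `Σ̃ = Cov(X̃) = E[X̃ X̃ᵀ]` (note `X̃` is centred). -/
noncomputable def truncCov {d : ℕ} (μ : Measure (EuclideanSpace ℝ (Fin d))) :
    Matrix (Fin d) (Fin d) ℝ :=
  Matrix.of fun i j => ∫ x, truncCentred μ x i * truncCentred μ x j ∂μ

/-- The chi-squared divergence `χ²(ρ ‖ γ) = ∫ ((dρ/dγ) - 1)² dγ`. -/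
noncomputable def chiSqDiv {E : Type*} [MeasurableSpace E] (ρ γm : Measure E) : ℝ :=
  ∫ x, ((ρ.rnDeriv γm x).toReal - 1) ^ 2 ∂γm

/-- The Kullback–Leibler divergence `KL(ρ ‖ γ) = ∫ log (dρ/dγ) dρ`. -/
noncomputable def klDivReal {E : Type*} [MeasurableSpace E] (ρ γm : Measure E) : ℝ :=
  ∫ x, Real.log ((ρ.rnDeriv γm x).toReal) ∂ρ

/-- The Jacobian matrix `∇φ(x)` of a map `φ : ℝ^d → ℝ^d`, with entry `(i,j)` equal to
`∂φ_i/∂x_j (x)`. -/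
noncomputable def jacobianM {d : ℕ}
    (φ : EuclideanSpace ℝ (Fin d) → EuclideanSpace ℝ (Fin d))
    (x : EuclideanSpace ℝ (Fin d)) : Matrix (Fin d) (Fin d) ℝ :=
  Matrix.of fun i j => fderiv ℝ φ x (EuclideanSpace.single j (1 : ℝ)) i

/-- `τ` is a Stein kernel for the centred measure `ρ` relative to the standard Gaussian:
for all `φ ∈ C_c^∞(ℝ^d; ℝ^d)`, `E⟨X, φ(X)⟩ = E[tr(τ(X) ∇φ(X))]`. -/
def IsSteinKernel {d : ℕ} (ρ : Measure (EuclideanSpace ℝ (Fin d)))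
    (τ : EuclideanSpace ℝ (Fin d) → Matrix (Fin d) (Fin d) ℝ) : Prop :=
  ∀ φ : EuclideanSpace ℝ (Fin d) → EuclideanSpace ℝ (Fin d),
    ContDiff ℝ (⊤ : ℕ∞) φ → HasCompactSupport φ →
      ∫ x, ⟪x, φ x⟫ ∂ρ = ∫ x, Matrix.trace (τ x * jacobianM φ x) ∂ρ

section GaussianShift

variable {E : Type*} [NormedAddCommGroup E] [InnerProductSpace ℝ E] [FiniteDimensional ℝ E]
  [MeasurableSpace E] [BorelSpace E]

/-- The Lebesgue density of the standard Gaussian measure. -/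
def gaussianDensity (E : Type*) [NormedAddCommGroup E] [InnerProductSpace ℝ E] (z : E) : ℝ :=
  ((2 * π) ^ (Module.finrank ℝ E / 2 : ℝ))⁻¹ * rexp (-(‖z‖ ^ 2 / 2))

omit [FiniteDimensional ℝ E] [MeasurableSpace E] [BorelSpace E] in
lemma gaussianDensity_nonneg (z : E) : 0 ≤ gaussianDensity E z := by
  unfold gaussianDensity; positivity

omit [FiniteDimensional ℝ E] in
lemma measurable_gaussianDensity : Measurable (gaussianDensity E) := by
  unfold gaussianDensity; fun_prop

lemma integrable_gaussianDensity : Integrable (gaussianDensity E) := by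
  unfold gaussianDensity
  refine Integrable.const_mul ?_ _
  have h := (GaussianFourier.integrable_cexp_neg_mul_sq_norm_add (V := E) (b := (1 / 2 : ℂ))
    (by norm_num) 0 0).re
  refine h.congr (ae_of_all _ fun z => ?_)
  have : (-(1 / 2 : ℂ) * (‖z‖ : ℂ) ^ 2 + 0 * ((⟪(0 : E), z⟫ : ℝ) : ℂ)) =
    ((-(‖z‖ ^ 2 / 2) : ℝ) : ℂ) := by push_cast; ring
  simp only [this]
  exact Complex.exp_ofReal_re _

lemma stdGaussian_eq_withDensity :
    ProbabilityTheory.stdGaussian E =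
      volume.withDensity (fun z => ENNReal.ofReal (gaussianDensity E z)) := by
  have : IsFiniteMeasure (volume.withDensity (fun z => ENNReal.ofReal (gaussianDensity E z))) :=
    isFiniteMeasure_withDensity_ofReal integrable_gaussianDensity.2
  refine Measure.ext_of_charFun (funext fun t => ?_)
  rw [charFun_stdGaussian, charFun_apply, integral_withDensity_eq_integral_toReal_smul
    measurable_gaussianDensity.ennreal_ofReal (ae_of_all _ fun _ => ENNReal.ofReal_lt_top)]
  have h := GaussianFourier.integral_cexp_neg_mul_sq_norm_add (V := E) (b := (1 / 2 : ℂ))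
    (by norm_num) Complex.I t
  have h2 : ∀ z : E, (ENNReal.ofReal (gaussianDensity E z)).toReal •
      Complex.exp (((⟪z, t⟫ : ℝ) : ℂ) * Complex.I) =
      (((2 * π) ^ (Module.finrank ℝ E / 2 : ℝ) : ℝ) : ℂ)⁻¹ *
      Complex.exp (-(1 / 2 : ℂ) * (‖z‖ : ℂ) ^ 2 + Complex.I * ((⟪t, z⟫ : ℝ) : ℂ)) := by
    intro z
    rw [ENNReal.toReal_ofReal (gaussianDensity_nonneg z), Complex.real_smul, gaussianDensity,
      Complex.exp_add, real_inner_comm]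
    push_cast
    rw [mul_assoc, mul_comm Complex.I]
    congr 3
    ring_nf
  simp_rw [h2]
  rw [integral_const_mul, h]
  have hpi : ((π : ℂ) / (1 / 2)) ^ (Module.finrank ℝ E / 2 : ℂ) =
      (((2 * π) ^ (Module.finrank ℝ E / 2 : ℝ) : ℝ) : ℂ) := by
    rw [Complex.ofReal_cpow (by positivity)]
    push_cast
    congr 1
    ring
  rw [hpi, ← mul_assoc, inv_mul_cancel₀, one_mul, Complex.I_sq]
  · congr 1; ring
  · exact_mod_cast (by positivity : ((2 * π) ^ (Module.finrank ℝ E / 2 : ℝ) : ℝ) ≠ 0)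

lemma stdGaussian_absolutelyContinuous :
    ProbabilityTheory.stdGaussian E ≪ (volume : Measure E) := by
  rw [stdGaussian_eq_withDensity]
  exact withDensity_absolutelyContinuous _ _

lemma lintegral_add_left_stdGaussian (a : E) {f : E → ℝ≥0∞} (hf : Measurable f) :
    ∫⁻ z, f (a + z) ∂ProbabilityTheory.stdGaussian E =
      ∫⁻ z, ENNReal.ofReal (rexp (⟪a, z⟫ - ‖a‖ ^ 2 / 2)) * f z ∂ProbabilityTheory.stdGaussian E := by
  have hm := (measurable_gaussianDensity (E := E)).ennreal_ofReal
  rw [stdGaussian_eq_withDensity, lintegral_withDensity_eq_lintegral_mul _ hm (by fun_prop),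
    lintegral_withDensity_eq_lintegral_mul _ hm (by fun_prop),
    ← lintegral_add_left_eq_self (fun z => _) (-a)]
  refine lintegral_congr fun z => ?_
  simp only [Pi.mul_apply, add_neg_cancel_left, ← mul_assoc]
  rw [← ENNReal.ofReal_mul (gaussianDensity_nonneg z)]
  congr 2
  rw [gaussianDensity, gaussianDensity, mul_assoc, ← Real.exp_add]
  congr 2
  rw [← sub_eq_neg_add, norm_sub_sq_real, real_inner_comm]
  ring

lemma lintegral_exp_inner_stdGaussian (a : E) :
    ∫⁻ z, ENNReal.ofReal (rexp ⟪a, z⟫) ∂ProbabilityTheory.stdGaussian E =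
      ENNReal.ofReal (rexp (‖a‖ ^ 2 / 2)) := by
  have h := lintegral_add_left_stdGaussian a (f := fun _ => 1) measurable_const
  simp only [lintegral_const, measure_univ, mul_one] at h
  have h2 : ∀ z : E, ENNReal.ofReal (rexp ⟪a, z⟫) =
      ENNReal.ofReal (rexp (‖a‖ ^ 2 / 2)) * ENNReal.ofReal (rexp (⟪a, z⟫ - ‖a‖ ^ 2 / 2)) := by
    intro z
    rw [← ENNReal.ofReal_mul (by positivity), ← Real.exp_add]
    congr 2; ring
  simp_rw [h2]
  rw [lintegral_const_mul _ (by fun_prop), ← h, mul_one]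

end GaussianShift

section Flow

open Set Filter Topology
open scoped NNReal

/-- A time-dependent vector field that is jointly continuous, bounded by `R`, and `K`-Lipschitz in
space uniformly in time. -/
structure IsLipschitzField {E : Type*} [NormedAddCommGroup E] (v : ℝ → E → E) (K R : ℝ≥0) :
    Prop where
  continuous : Continuous (Function.uncurry v)
  lipschitz : ∀ t, LipschitzWith K (v t)
  norm_le : ∀ t y, ‖v t y‖ ≤ R

/-- `A s y t` is the value at time `t` of the integral curve of `v` on `[0, 1]` which is at `y` at
time `s`. -/
structure IsFlowOf {E : Type*} [NormedAddCommGroup E] [NormedSpace ℝ E]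
    (A : ℝ → E → ℝ → E) (v : ℝ → E → E) : Prop where
  self : ∀ s ∈ Icc (0 : ℝ) 1, ∀ y, A s y s = y
  hasDeriv : ∀ s ∈ Icc (0 : ℝ) 1, ∀ y, ∀ t ∈ Icc (0 : ℝ) 1,
    HasDerivWithinAt (A s y) (v t (A s y t)) (Icc 0 1) t

variable {E : Type*} [NormedAddCommGroup E] [NormedSpace ℝ E] {v : ℝ → E → E} {K R : ℝ≥0}
  {A : ℝ → E → ℝ → E}

lemma IsLipschitzField.exists_flow [CompleteSpace E] (hv : IsLipschitzField v K R) :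
    ∃ A : ℝ → E → ℝ → E, IsFlowOf A v := by
  have h : ∀ s : ℝ, ∀ y : E, ∃ α : ℝ → E, s ∈ Icc (0 : ℝ) 1 → α s = y ∧
      ∀ t ∈ Icc (0 : ℝ) 1, HasDerivWithinAt α (v t (α t)) (Icc 0 1) t := by
    intro s y
    by_cases hs : s ∈ Icc (0 : ℝ) 1
    · have hp : IsPicardLindelof v (tmin := 0) (tmax := 1) ⟨s, hs⟩ y R 0 R K :=
        { lipschitzOnWith := fun t _ => (hv.lipschitz t).lipschitzOnWith
          continuousOn := fun x _ => (hv.continuous.comp (Continuous.prodMk_left x)).continuousOn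
          norm_le := fun t _ x _ => hv.norm_le t x
          mul_max_le := by
            have : max (1 - s) (s - 0) ≤ 1 := max_le (by linarith [hs.1]) (by linarith [hs.2])
            simpa using mul_le_mul_of_nonneg_left this R.2 }
      obtain ⟨α, h1, h2⟩ := hp.exists_eq_forall_mem_Icc_hasDerivWithinAt₀
      exact ⟨α, fun _ => ⟨h1, h2⟩⟩
    · exact ⟨0, fun h => absurd h hs⟩
  choose A hA using h
  exact ⟨A, ⟨fun s hs y => (hA s y hs).1, fun s hs y => (hA s y hs).2⟩⟩

/-- Backward-in-time Grönwall estimate for two integral curves on `[0, 1]`. -/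
lemma IsLipschitzField.dist_le_of_le (hv : IsLipschitzField v K R) {α β : ℝ → E}
    (hα : ∀ t ∈ Icc (0 : ℝ) 1, HasDerivWithinAt α (v t (α t)) (Icc 0 1) t)
    (hβ : ∀ t ∈ Icc (0 : ℝ) 1, HasDerivWithinAt β (v t (β t)) (Icc 0 1) t)
    {t s : ℝ} (ht : 0 ≤ t) (hts : t ≤ s) (hs : s ≤ 1) :
    dist (α t) (β t) ≤ rexp K * dist (α s) (β s) := by
  have key : ∀ α : ℝ → E, (∀ t ∈ Icc (0 : ℝ) 1, HasDerivWithinAt α (v t (α t)) (Icc 0 1) t) →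
      ContinuousOn (fun τ => α (-τ)) (Icc (-s) (-t)) ∧
      ∀ τ ∈ Ico (-s) (-t), HasDerivWithinAt (fun τ => α (-τ)) ((fun τ y => -v (-τ) y) τ (α (-τ)))
        (Ici τ) τ := by
    intro α hα
    have hd : ∀ τ ∈ Icc (-s) (-t),
        HasDerivWithinAt (fun τ => α (-τ)) (-v (-τ) (α (-τ))) (Icc (-1) 0) τ := by
      intro τ hτ
      have hm : -τ ∈ Icc (0 : ℝ) 1 := ⟨by linarith [hτ.2], by linarith [hτ.1]⟩
      have := (hα (-τ) hm).scomp (h := fun τ => -τ) τ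
        (hasDerivAt_neg τ).hasDerivWithinAt (s := Icc (-1) 0)
        (fun x hx => ⟨by linarith [hx.2], by linarith [hx.1]⟩)
      simpa [Function.comp_def] using this
    refine ⟨fun τ hτ => (hd τ hτ).continuousWithinAt.mono
      (Icc_subset_Icc (by linarith) (by linarith)), fun τ hτ => ?_⟩
    refine (hd τ (Ico_subset_Icc_self hτ)).mono_of_mem_nhdsWithin ?_
    exact Filter.mem_of_superset (Icc_mem_nhdsGE (show τ < 0 by linarith [hτ.2]))
      (Icc_subset_Icc_left (by linarith [hτ.1]))
  have hl : ∀ τ, LipschitzWith K ((fun τ y => -v (-τ) y) τ) := fun τ => (hv.lipschitz (-τ)).neg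
  have := dist_le_of_trajectories_ODE hl (key α hα).1 (key α hα).2 (key β hβ).1 (key β hβ).2
    (δ := dist (α s) (β s)) (by simp only [neg_neg]; exact le_rfl) (-t) ⟨by linarith, le_rfl⟩
  simp only [neg_neg] at this
  refine this.trans ?_
  rw [mul_comm]
  gcongr
  have : (0 : ℝ) ≤ K := K.2
  nlinarith

lemma IsFlowOf.lipschitzWith (hA : IsFlowOf A v) (hv : IsLipschitzField v K R) {t s : ℝ}
    (ht : 0 ≤ t) (hts : t ≤ s) (hs : s ≤ 1) :
    LipschitzWith (Real.toNNReal (rexp K)) (fun y => A s y t) := by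
  refine LipschitzWith.of_dist_le_mul fun y y' => ?_
  have hs' : s ∈ Icc (0 : ℝ) 1 := ⟨ht.trans hts, hs⟩
  have := hv.dist_le_of_le (hA.hasDeriv s hs' y) (hA.hasDeriv s hs' y') ht hts hs
  rwa [hA.self s hs', hA.self s hs', ← Real.coe_toNNReal _ (Real.exp_nonneg _)] at this

lemma IsFlowOf.comp_eq (hA : IsFlowOf A v) (hv : IsLipschitzField v K R) {t s s' : ℝ}
    (ht : 0 ≤ t) (hts : t ≤ s) (hss' : s ≤ s') (hs' : s' ≤ 1) (z : E) :
    A s (A s' z s) t = A s' z t := by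
  have hs : s ∈ Icc (0 : ℝ) 1 := ⟨ht.trans hts, hss'.trans hs'⟩
  have := hv.dist_le_of_le (hA.hasDeriv s hs (A s' z s))
    (hA.hasDeriv s' ⟨hs.1.trans hss', hs'⟩ z) ht hts hs.2
  rw [hA.self s hs, dist_self, mul_zero] at this
  exact dist_le_zero.1 this

/-- If the field stays `ε`-close to `w` along an integral curve, the curve is `ε`-close to linear. -/
lemma IsFlowOf.norm_sub_sub_le (hA : IsFlowOf A v) {s a b : ℝ} (hs : s ∈ Icc (0 : ℝ) 1)
    (ha : 0 ≤ a) (hab : a ≤ b) (hb : b ≤ 1) (y w : E) {ε : ℝ}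
    (h : ∀ t ∈ Icc a b, ‖v t (A s y t) - w‖ ≤ ε) :
    ‖A s y b - A s y a - (b - a) • w‖ ≤ ε * (b - a) := by
  have hd : ∀ t ∈ Icc a b, HasDerivWithinAt (fun t => A s y t - t • w) (v t (A s y t) - w)
      (Icc a b) t := by
    intro t ht
    have h1 := (hA.hasDeriv s hs y t ⟨ha.trans ht.1, ht.2.trans hb⟩).mono
      (Icc_subset_Icc ha hb)
    have h2 : HasDerivWithinAt (fun t : ℝ => t • w) w (Icc a b) t := by
      simpa using ((hasDerivAt_id t).smul_const w).hasDerivWithinAt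
    exact h1.sub h2
  have := norm_image_sub_le_of_norm_deriv_le_segment' hd
    (fun t ht => h t (Ico_subset_Icc_self ht)) b ⟨hab, le_rfl⟩
  convert this using 2
  rw [sub_smul]; abel

lemma IsFlowOf.norm_sub_le (hA : IsFlowOf A v) (hv : IsLipschitzField v K R) {s a b : ℝ}
    (hs : s ∈ Icc (0 : ℝ) 1) (ha : 0 ≤ a) (hab : a ≤ b) (hb : b ≤ 1) (y : E) :
    ‖A s y b - A s y a‖ ≤ R * (b - a) := by
  simpa using hA.norm_sub_sub_le hs ha hab hb y 0 (ε := R) (fun t _ => by simpa using hv.norm_le _ _)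

/-- The right derivative at `s' = s` of the backward flow from time `s'` to time `s` along a moving
starting point. -/
lemma IsFlowOf.hasDerivWithinAt_start (hA : IsFlowOf A v) (hv : IsLipschitzField v K R) {s : ℝ}
    (hs : s ∈ Ico (0 : ℝ) 1) (x y : E) :
    HasDerivWithinAt (fun s' => A s' (y + (s' - s) • x) s) (x - v s y) (Ioi s) s := by
  rw [hasDerivWithinAt_iff_isLittleO, Asymptotics.isLittleO_iff]
  intro ε hε
  have hcont := hv.continuous.continuousAt (x := (s, y))
  rw [Metric.continuousAt_iff] at hcont
  obtain ⟨δ, hδ, hclose⟩ := hcont ε hε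
  set M : ℝ := R + ‖x‖ + 1 with hM
  have hR : (0 : ℝ) ≤ R := R.2
  have hMpos : 0 < M := by positivity
  have hev : ∀ᶠ s' in 𝓝[>] s, s' < min 1 (s + δ / M) :=
    (eventually_lt_nhds (lt_min hs.2 (by linarith [div_pos hδ hMpos]))).filter_mono
      nhdsWithin_le_nhds
  filter_upwards [hev, self_mem_nhdsWithin] with s' hs' hlt
  have hlt : s < s' := hlt
  have h1 : s' < 1 := hs'.trans_le (min_le_left _ _)
  have h2 : s' - s < δ / M := by linarith [hs'.trans_le (min_le_right _ _)]
  have h2' : M * (s' - s) < δ := by rwa [lt_div_iff₀' hMpos] at h2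
  have hm : s' ∈ Icc (0 : ℝ) 1 := ⟨hs.1.trans hlt.le, h1.le⟩
  set z := y + (s' - s) • x with hz
  have hbd : ∀ t ∈ Icc s s', ‖v t (A s' z t) - v s y‖ ≤ ε := by
    intro t ht
    have hd1 : ‖A s' z s' - A s' z t‖ ≤ R * (s' - t) :=
      hA.norm_sub_le hv hm (hs.1.trans ht.1) ht.2 h1.le z
    rw [hA.self s' hm] at hd1
    have hd2 : dist (A s' z t) y < δ := by
      calc dist (A s' z t) y = ‖-(z - A s' z t) + (s' - s) • x‖ := by
            rw [dist_eq_norm, hz]; congr 1; abel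
        _ ≤ R * (s' - t) + (s' - s) * ‖x‖ := by
            refine (norm_add_le _ _).trans (add_le_add (by rwa [norm_neg]) ?_)
            rw [norm_smul, Real.norm_of_nonneg (by linarith)]
        _ ≤ M * (s' - s) := by
            have : (R : ℝ) * (s' - t) ≤ R * (s' - s) := by gcongr; exact ht.1
            rw [hM]; nlinarith
        _ < δ := h2'
    have hd3 : dist t s < δ := by
      rw [Real.dist_eq, abs_of_nonneg (by linarith [ht.1])]
      have : s' - s ≤ M * (s' - s) := by
        rw [hM]; nlinarith [norm_nonneg x, mul_nonneg hR (sub_nonneg.2 hlt.le),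
          mul_nonneg (norm_nonneg x) (sub_nonneg.2 hlt.le)]
      linarith [ht.2]
    have := hclose (x := (t, A s' z t)) (by rw [Prod.dist_eq]; exact max_lt hd3 hd2)
    rw [dist_eq_norm] at this
    exact this.le
  have hfin := hA.norm_sub_sub_le hm hs.1 hlt.le h1.le z (v s y) hbd
  rw [hA.self s' hm] at hfin
  have hss : s ∈ Icc (0 : ℝ) 1 := ⟨hs.1, hs.2.le⟩
  rw [sub_self, zero_smul, add_zero, hA.self s hss, Real.norm_of_nonneg (sub_nonneg.2 hlt.le)]
  have e : A s' z s - y - (s' - s) • (x - v s y) = -(z - A s' z s - (s' - s) • v s y) := by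
    rw [hz, smul_sub]; abel
  rw [e, norm_neg]
  exact hfin

end Flow

section Superposition

open Set Filter Topology
open scoped NNReal

variable {E : Type*} [NormedAddCommGroup E] [InnerProductSpace ℝ E] [FiniteDimensional ℝ E]
  [MeasurableSpace E] [BorelSpace E] {v : ℝ → E → E} {K R : ℝ≥0} {A : ℝ → E → ℝ → E}
  {Ω : Type*} [MeasurableSpace Ω] {P : Measure Ω} [IsProbabilityMeasure P] {X Z : Ω → E}

/-- The weak continuity equation: if `v s` is the conditional expectation of `X` given `s X + Z`,
then the expectation of a bounded Lipschitz observable transported by the flow is constant. -/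
lemma integral_comp_flow_eq (hA : IsFlowOf A v) (hv : IsLipschitzField v K R)
    (hX : Measurable X) (hZ : Measurable Z) (hXR : ∀ᵐ ω ∂P, ‖X ω‖ ≤ R)
    (hac : ∀ s ∈ Icc (0 : ℝ) 1, P.map (fun ω => s • X ω + Z ω) ≪ volume)
    (hcond : ∀ s ∈ Icc (0 : ℝ) 1, ∀ g : E → E →L[ℝ] ℂ, Measurable g → (∃ C, ∀ y, ‖g y‖ ≤ C) →
      ∫ ω, g (s • X ω + Z ω) (X ω - v s (s • X ω + Z ω)) ∂P = 0)
    {φ : E → ℂ} {L : ℝ≥0} (hφ : LipschitzWith L φ) {C : ℝ} (hφC : ∀ y, ‖φ y‖ ≤ C)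
    {t s : ℝ} (ht : 0 ≤ t) (hts : t ≤ s) (hs : s ≤ 1) :
    ∫ ω, φ (A s (s • X ω + Z ω) t) ∂P = ∫ ω, φ (t • X ω + Z ω) ∂P := by
  set Y : ℝ → Ω → E := fun s ω => s • X ω + Z ω with hY
  have hYm : ∀ s, Measurable (Y s) := fun s => by fun_prop
  set u : ℝ → E → ℂ := fun s y => φ (A s y t) with hu
  set M : ℝ≥0 := L * Real.toNNReal (rexp K) with hM
  have hul : ∀ s, t ≤ s → s ≤ 1 → LipschitzWith M (u s) := fun s h1 h2 =>
    hφ.comp (hA.lipschitzWith hv ht h1 h2)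
  have hum : ∀ s, t ≤ s → s ≤ 1 → Measurable fun ω => u s (Y s ω) := fun s h1 h2 =>
    (hul s h1 h2).continuous.measurable.comp (hYm s)
  have hui : ∀ s, t ≤ s → s ≤ 1 → Integrable (fun ω => u s (Y s ω)) P := fun s h1 h2 =>
    Integrable.of_bound (hum s h1 h2).aestronglyMeasurable C (ae_of_all _ fun ω => hφC _)
  -- the flow from time `s'` factors through time `s`
  have hfac : ∀ s s', t ≤ s → s ≤ s' → s' ≤ 1 → ∀ ω,
      u s' (Y s' ω) = u s (A s' (Y s ω + (s' - s) • X ω) s) := by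
    intro s s' h1 h2 h3 ω
    simp only [hu]
    rw [hA.comp_eq hv ht h1 h2 h3]
    congr 2
    simp only [hY, sub_smul]; abel
  have hdiff : ∀ s s', t ≤ s → s ≤ s' → s' ≤ 1 → ∀ ω, ‖X ω‖ ≤ R →
      ‖u s' (Y s' ω) - u s (Y s ω)‖ ≤ M * (2 * R) * (s' - s) := by
    intro s s' h1 h2 h3 ω hω
    rw [hfac s s' h1 h2 h3]
    refine ((hul s h1 (h2.trans h3)).norm_sub_le _ _).trans ?_
    rw [mul_assoc]
    gcongr
    have hs' : s' ∈ Icc (0 : ℝ) 1 := ⟨ht.trans (h1.trans h2), h3⟩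
    have := hA.norm_sub_le hv hs' (ht.trans h1) h2 h3 (Y s ω + (s' - s) • X ω)
    rw [hA.self s' hs', norm_sub_rev] at this
    calc ‖A s' (Y s ω + (s' - s) • X ω) s - Y s ω‖
        = ‖(A s' (Y s ω + (s' - s) • X ω) s - (Y s ω + (s' - s) • X ω)) + (s' - s) • X ω‖ := by
          congr 1; abel
      _ ≤ R * (s' - s) + (s' - s) * R := by
          refine (norm_add_le _ _).trans (add_le_add this ?_)
          rw [norm_smul, Real.norm_of_nonneg (sub_nonneg.2 h2)]
          gcongr
      _ = 2 * R * (s' - s) := by ring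
  set F : ℝ → ℂ := fun s => ∫ ω, u s (Y s ω) ∂P with hF
  have hFl : ∀ s s', t ≤ s → s ≤ s' → s' ≤ 1 → ‖F s' - F s‖ ≤ M * (2 * R) * (s' - s) := by
    intro s s' h1 h2 h3
    simp only [hF]
    rw [← integral_sub (hui s' (h1.trans h2) h3) (hui s h1 (h2.trans h3))]
    have := norm_integral_le_of_norm_le_const (μ := P)
      (hXR.mono fun ω hω => hdiff s s' h1 h2 h3 ω hω)
    simpa using this
  have hFc : ContinuousOn F (Icc t 1) := by
    have : LipschitzOnWith (M * (2 * R)) F (Icc t 1) := by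
      refine LipschitzOnWith.of_dist_le_mul fun a ha b hb => ?_
      rcases le_total a b with hab | hab
      · rw [dist_comm, dist_eq_norm, dist_comm, Real.dist_eq, abs_of_nonneg (sub_nonneg.2 hab)]
        exact hFl a b ha.1 hab hb.2
      · rw [dist_eq_norm, Real.dist_eq, abs_of_nonneg (sub_nonneg.2 hab)]
        exact hFl b a hb.1 hab ha.2
    exact this.continuousOn
  have hFd : ∀ s ∈ Ico t 1, HasDerivWithinAt F 0 (Ici s) s := by
    intro s hs
    have hs01 : s ∈ Ico (0 : ℝ) 1 := ⟨ht.trans hs.1, hs.2⟩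
    have hs01' := Ico_subset_Icc_self hs01
    rw [← hasDerivWithinAt_Ioi_iff_Ici, hasDerivWithinAt_iff_tendsto_slope' (by simp)]
    have hev : ∀ᶠ s' in 𝓝[>] s, s < s' ∧ s' ≤ 1 := by
      filter_upwards [Ioc_mem_nhdsGT hs.2] with s' h using ⟨h.1, h.2⟩
    have hdae : ∀ᵐ ω ∂P, DifferentiableAt ℝ (u s) (Y s ω) := by
      have h1 : ∀ᵐ y ∂(P.map (Y s)), DifferentiableAt ℝ (u s) y :=
        (hac s hs01').ae_le (hul s hs.1 hs.2.le).ae_differentiableAt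
      exact ae_of_ae_map (hYm s).aemeasurable h1
    have hzero : ∫ ω, fderiv ℝ (u s) (Y s ω) (X ω - v s (Y s ω)) ∂P = 0 :=
      hcond s hs01' (fderiv ℝ (u s)) (measurable_fderiv ℝ _)
        ⟨M, fun y => norm_fderiv_le_of_lipschitz ℝ (hul s hs.1 hs.2.le)⟩
    have hlim : Tendsto (fun s' => ∫ ω, (s' - s)⁻¹ • (u s' (Y s' ω) - u s (Y s ω)) ∂P) (𝓝[>] s)
        (𝓝 (∫ ω, fderiv ℝ (u s) (Y s ω) (X ω - v s (Y s ω)) ∂P)) := by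
      refine tendsto_integral_filter_of_dominated_convergence (fun _ => M * (2 * R)) ?_ ?_
        (integrable_const _) ?_
      · filter_upwards [hev] with s' h
        exact (((hui s' (hs.1.trans h.1.le) h.2).sub (hui s hs.1 hs.2.le)).smul (s' - s)⁻¹).1
      · filter_upwards [hev] with s' h
        filter_upwards [hXR] with ω hω
        rw [norm_smul, norm_inv, Real.norm_of_nonneg (sub_nonneg.2 h.1.le),
          inv_mul_le_iff₀ (sub_pos.2 h.1), mul_comm]
        exact hdiff s s' hs.1 h.1.le h.2 ω hω
      · filter_upwards [hdae] with ω hω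
        have h0 : A s (Y s ω + (s - s) • X ω) s = Y s ω := by
          rw [sub_self, zero_smul, add_zero, hA.self s hs01']
        have hcomp := HasFDerivAt.comp_hasDerivWithinAt (x := s)
          (f := fun s' => A s' (Y s ω + (s' - s) • X ω) s) (l := u s)
          (l' := fderiv ℝ (u s) (Y s ω)) (by rw [h0]; exact hω.hasFDerivAt)
          (hA.hasDerivWithinAt_start hv hs01 (X ω) (Y s ω))
        rw [hasDerivWithinAt_iff_tendsto_slope' (by simp)] at hcomp
        refine hcomp.congr' ?_
        filter_upwards [hev] with s' h
        rw [slope_def_module, Function.comp_apply, Function.comp_apply, h0,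
          hfac s s' hs.1 h.1.le h.2 ω]
    rw [hzero] at hlim
    refine hlim.congr' ?_
    filter_upwards [hev] with s' h
    rw [slope_def_module, integral_smul,
      integral_sub (hui s' (hs.1.trans h.1.le) h.2) (hui s hs.1 hs.2.le)]
  have hconst := constant_of_has_deriv_right_zero hFc hFd s ⟨hts, hs⟩
  simp only [hF, hu] at hconst
  rw [hconst]
  simp_rw [hA.self t ⟨ht, hts.trans hs⟩, hY]

/-- The flow of the conditional expectations `v s = 𝔼[X | s X + Z]` transports the laws of
`s X + Z` to each other. -/
lemma map_flow_eq (hA : IsFlowOf A v) (hv : IsLipschitzField v K R)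
    (hX : Measurable X) (hZ : Measurable Z) (hXR : ∀ᵐ ω ∂P, ‖X ω‖ ≤ R)
    (hac : ∀ s ∈ Icc (0 : ℝ) 1, P.map (fun ω => s • X ω + Z ω) ≪ volume)
    (hcond : ∀ s ∈ Icc (0 : ℝ) 1, ∀ g : E → E →L[ℝ] ℂ, Measurable g → (∃ C, ∀ y, ‖g y‖ ≤ C) →
      ∫ ω, g (s • X ω + Z ω) (X ω - v s (s • X ω + Z ω)) ∂P = 0)
    {t s : ℝ} (ht : 0 ≤ t) (hts : t ≤ s) (hs : s ≤ 1) :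
    P.map (fun ω => A s (s • X ω + Z ω) t) = P.map (fun ω => t • X ω + Z ω) := by
  have hm1 : Measurable fun ω => A s (s • X ω + Z ω) t :=
    (hA.lipschitzWith hv ht hts hs).continuous.measurable.comp (by fun_prop)
  have hm2 : Measurable fun ω => t • X ω + Z ω := by fun_prop
  have := Measure.isProbabilityMeasure_map (μ := P) hm1.aemeasurable
  have := Measure.isProbabilityMeasure_map (μ := P) hm2.aemeasurable
  refine Measure.ext_of_charFun (funext fun a => ?_)
  have hexp : LipschitzWith ‖a‖₊ fun x : E => Complex.exp (((⟪x, a⟫ : ℝ) : ℂ) * Complex.I) := by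
    refine LipschitzWith.of_dist_le_mul fun x y => ?_
    have h1 : ∀ r : ℝ, HasDerivAt (fun r : ℝ => Complex.exp ((r : ℂ) * Complex.I))
        (Complex.exp ((r : ℂ) * Complex.I) * Complex.I) r := fun r => by
      have := ((Complex.ofRealCLM.hasDerivAt (x := r)).mul_const Complex.I).cexp
      simpa using this
    have h2 : LipschitzWith 1 (fun r : ℝ => Complex.exp ((r : ℂ) * Complex.I)) := by
      refine lipschitzWith_of_nnnorm_deriv_le (fun r => (h1 r).differentiableAt) fun r => ?_
      rw [(h1 r).deriv, ← NNReal.coe_le_coe]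
      simp
    refine (h2.dist_le_mul ⟪x, a⟫ ⟪y, a⟫).trans ?_
    rw [NNReal.coe_one, one_mul, Real.dist_eq, ← inner_sub_left, dist_eq_norm, mul_comm]
    exact abs_real_inner_le_norm _ _
  have hmeas : ∀ Q : Measure E, AEStronglyMeasurable
      (fun x : E => Complex.exp (((⟪x, a⟫ : ℝ) : ℂ) * Complex.I)) Q :=
    fun Q => hexp.continuous.measurable.aestronglyMeasurable
  rw [charFun_apply, charFun_apply, integral_map hm1.aemeasurable (hmeas _),
    integral_map hm2.aemeasurable (hmeas _)]
  exact integral_comp_flow_eq hA hv hX hZ hXR hac hcond hexp (C := 1)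
    (fun y => by rw [Complex.norm_exp_ofReal_mul_I]) ht hts hs

end Superposition

section GaussianMixture

open Set Filter Topology
open scoped NNReal

variable {E : Type*} [NormedAddCommGroup E] [InnerProductSpace ℝ E]

/-- The density at `y` of the law of `t x + Z` relative to that of the standard Gaussian `Z`. -/
def tiltWeight (t : ℝ) (x y : E) : ℝ := rexp (t * ⟪x, y⟫ - t ^ 2 * ‖x‖ ^ 2 / 2)

lemma tiltWeight_pos (t : ℝ) (x y : E) : 0 < tiltWeight t x y := Real.exp_pos _

lemma continuous_tiltWeight : Continuous fun p : ℝ × E × E => tiltWeight p.1 p.2.1 p.2.2 := by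
  unfold tiltWeight; fun_prop

lemma tiltWeight_le {t R : ℝ} (ht : t ∈ Icc (0 : ℝ) 1) {x : E} (hx : ‖x‖ ≤ R) (y : E) :
    tiltWeight t x y ≤ rexp (R * ‖y‖) := by
  refine Real.exp_le_exp.2 ?_
  have h1 : t * ⟪x, y⟫ ≤ R * ‖y‖ := by
    have h2 : ⟪x, y⟫ ≤ R * ‖y‖ := (real_inner_le_norm x y).trans (by gcongr)
    have h3 : 0 ≤ R * ‖y‖ := mul_nonneg ((norm_nonneg x).trans hx) (norm_nonneg y)
    nlinarith [ht.1, ht.2]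
  have : 0 ≤ t ^ 2 * ‖x‖ ^ 2 / 2 := by positivity
  linarith

lemma tiltWeight_sub_le {t R : ℝ} (ht : t ∈ Icc (0 : ℝ) 1) {x : E} (hx : ‖x‖ ≤ R) {y y' : E}
    (hy : R * ‖y' - y‖ ≤ 1) :
    |tiltWeight t x y' - tiltWeight t x y| ≤ 2 * (R * ‖y' - y‖) * tiltWeight t x y' := by
  have h1 : |t * ⟪x, y - y'⟫| ≤ R * ‖y' - y‖ := by
    rw [abs_mul, abs_of_nonneg ht.1]
    have h2 : |⟪x, y - y'⟫| ≤ R * ‖y' - y‖ := by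
      rw [norm_sub_rev y' y]
      exact (abs_real_inner_le_norm x _).trans (by gcongr)
    nlinarith [ht.1, ht.2, abs_nonneg ⟪x, y - y'⟫]
  have h3 : tiltWeight t x y = tiltWeight t x y' * rexp (t * ⟪x, y - y'⟫) := by
    rw [tiltWeight, tiltWeight, ← Real.exp_add, inner_sub_right]; congr 1; ring
  rw [h3, ← mul_one_sub, abs_mul, abs_of_pos (tiltWeight_pos _ _ _), mul_comm, abs_sub_comm]
  exact mul_le_mul_of_nonneg_right ((Real.abs_exp_sub_one_le (h1.trans hy)).trans
    (mul_le_mul_of_nonneg_left h1 zero_le_two)) (tiltWeight_pos _ _ _).le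

variable [MeasurableSpace E] [BorelSpace E] [FiniteDimensional ℝ E]

lemma measurable_tiltWeight (t : ℝ) (y : E) : Measurable fun x => tiltWeight t x y := by
  unfold tiltWeight; fun_prop

/-- The density of `t X + Z` relative to the standard Gaussian `Z`, for `X ∼ ν`. -/
def mixDensity (ν : Measure E) (t : ℝ) (y : E) : ℝ := ∫ x, tiltWeight t x y ∂ν

/-- The unnormalized conditional expectation of `X` given `t X + Z = y`, for `X ∼ ν`. -/
def mixMoment (ν : Measure E) (t : ℝ) (y : E) : E := ∫ x, tiltWeight t x y • x ∂ν

/-- The conditional expectation of `X` given `t X + Z = y`, for `X ∼ ν`. -/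
def mixMean (ν : Measure E) (t : ℝ) (y : E) : E := (mixDensity ν t y)⁻¹ • mixMoment ν t y

variable {ν : Measure E} [IsProbabilityMeasure ν] {R : ℝ≥0}

lemma integrable_tiltWeight (hR : ∀ᵐ x ∂ν, ‖x‖ ≤ R) {t : ℝ} (ht : t ∈ Icc (0 : ℝ) 1) (y : E) :
    Integrable (fun x => tiltWeight t x y) ν := by
  refine Integrable.of_bound (measurable_tiltWeight t y).aestronglyMeasurable (rexp (R * ‖y‖)) ?_
  filter_upwards [hR] with x hx
  rw [Real.norm_of_nonneg (tiltWeight_pos _ _ _).le]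
  exact tiltWeight_le ht hx y

lemma integrable_id_of_bound (hR : ∀ᵐ x ∂ν, ‖x‖ ≤ R) : Integrable (fun x => x) ν :=
  Integrable.of_bound measurable_id.aestronglyMeasurable R hR

lemma integrable_tiltWeight_smul (hR : ∀ᵐ x ∂ν, ‖x‖ ≤ R) {t : ℝ} (ht : t ∈ Icc (0 : ℝ) 1)
    (y : E) : Integrable (fun x => tiltWeight t x y • x) ν := by
  refine Integrable.of_bound
    ((measurable_tiltWeight t y).smul measurable_id).aestronglyMeasurable (rexp (R * ‖y‖) * R) ?_
  filter_upwards [hR] with x hx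
  rw [norm_smul, Real.norm_of_nonneg (tiltWeight_pos _ _ _).le]
  exact mul_le_mul (tiltWeight_le ht hx y) hx (norm_nonneg _) (Real.exp_nonneg _)

lemma mixDensity_pos (hR : ∀ᵐ x ∂ν, ‖x‖ ≤ R) {t : ℝ} (ht : t ∈ Icc (0 : ℝ) 1) (y : E) :
    0 < mixDensity ν t y := by
  refine (integral_pos_iff_support_of_nonneg (fun x => (tiltWeight_pos t x y).le)
    (integrable_tiltWeight hR ht y)).2 ?_
  have : Function.support (fun x => tiltWeight t x y) = univ :=
    eq_univ_of_forall fun x => (tiltWeight_pos t x y).ne'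
  rw [this, measure_univ]
  exact one_pos

lemma mixDensity_smul_mixMean (hR : ∀ᵐ x ∂ν, ‖x‖ ≤ R) {t : ℝ} (ht : t ∈ Icc (0 : ℝ) 1) (y : E) :
    mixDensity ν t y • mixMean ν t y = mixMoment ν t y :=
  smul_inv_smul₀ (mixDensity_pos hR ht y).ne' _

lemma norm_mixMean_sub_le (hR : ∀ᵐ x ∂ν, ‖x‖ ≤ R) {t : ℝ} (ht : t ∈ Icc (0 : ℝ) 1) (y w : E)
    {f : E → E} (hf : ∫ x, f x ∂ν = mixDensity ν t y • (mixMean ν t y - w)) {C : ℝ}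
    (hC : ∀ᵐ x ∂ν, ‖f x‖ ≤ C * tiltWeight t x y) : ‖mixMean ν t y - w‖ ≤ C := by
  have h := norm_integral_le_of_norm_le ((integrable_tiltWeight hR ht y).const_mul C) hC
  rw [hf, norm_smul, Real.norm_of_nonneg (mixDensity_pos hR ht y).le, integral_const_mul] at h
  rw [mul_comm] at h
  exact le_of_mul_le_mul_right h (mixDensity_pos hR ht y)

lemma norm_mixMean_le (hR : ∀ᵐ x ∂ν, ‖x‖ ≤ R) {t : ℝ} (ht : t ∈ Icc (0 : ℝ) 1) (y : E) :
    ‖mixMean ν t y‖ ≤ R := by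
  have h := norm_mixMean_sub_le hR ht y 0 (f := fun x => tiltWeight t x y • x) (C := R)
    (by rw [sub_zero, mixDensity_smul_mixMean hR ht, mixMoment]) ?_
  · simpa using h
  · filter_upwards [hR] with x hx
    rw [norm_smul, Real.norm_of_nonneg (tiltWeight_pos _ _ _).le, mul_comm]
    exact mul_le_mul_of_nonneg_right hx (tiltWeight_pos _ _ _).le

lemma lipschitzWith_mixMean (hR : ∀ᵐ x ∂ν, ‖x‖ ≤ R) {t : ℝ} (ht : t ∈ Icc (0 : ℝ) 1) :
    LipschitzWith (4 * R ^ 2) (mixMean ν t) := by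
  refine LipschitzWith.of_dist_le_mul fun y' y => ?_
  rw [dist_eq_norm, dist_eq_norm]
  push_cast
  have hR0 : (0 : ℝ) ≤ R := R.2
  rcases le_or_gt (R * ‖y' - y‖) 1 with hδ | hδ
  · have hi : Integrable
        (fun x => (tiltWeight t x y' - tiltWeight t x y) • mixMean ν t y) ν :=
      ((integrable_tiltWeight hR ht y').sub (integrable_tiltWeight hR ht y)).smul_const _
    have hi' : Integrable (fun x => tiltWeight t x y' • x - tiltWeight t x y • x) ν :=
      (integrable_tiltWeight_smul hR ht y').sub (integrable_tiltWeight_smul hR ht y)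
    refine norm_mixMean_sub_le hR ht y' _
      (f := fun x => (tiltWeight t x y' - tiltWeight t x y) • (x - mixMean ν t y)) ?_ ?_
    · have : ∀ x, (tiltWeight t x y' - tiltWeight t x y) • (x - mixMean ν t y) =
          (tiltWeight t x y' • x - tiltWeight t x y • x) -
            (tiltWeight t x y' - tiltWeight t x y) • mixMean ν t y := fun x => by
        rw [smul_sub, sub_smul]
      simp_rw [this]
      rw [integral_sub hi' hi, integral_smul_const,
        integral_sub (integrable_tiltWeight_smul hR ht y') (integrable_tiltWeight_smul hR ht y),
        integral_sub (integrable_tiltWeight hR ht y') (integrable_tiltWeight hR ht y)]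
      change mixMoment ν t y' - mixMoment ν t y -
        (mixDensity ν t y' - mixDensity ν t y) • mixMean ν t y = _
      rw [← mixDensity_smul_mixMean hR ht, ← mixDensity_smul_mixMean hR ht, smul_sub, sub_smul]
      abel
    · filter_upwards [hR] with x hx
      rw [norm_smul, Real.norm_eq_abs]
      have h1 := tiltWeight_sub_le ht hx hδ
      have h2 : ‖x - mixMean ν t y‖ ≤ 2 * R :=
        (norm_sub_le _ _).trans (by linarith [norm_mixMean_le hR ht y])
      calc |tiltWeight t x y' - tiltWeight t x y| * ‖x - mixMean ν t y‖
          ≤ (2 * (R * ‖y' - y‖) * tiltWeight t x y') * (2 * R) :=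
            mul_le_mul h1 h2 (norm_nonneg _) ((abs_nonneg _).trans h1)
        _ = 4 * R ^ 2 * ‖y' - y‖ * tiltWeight t x y' := by ring
  · refine (norm_sub_le _ _).trans ?_
    nlinarith [norm_mixMean_le hR ht y, norm_mixMean_le hR ht y']

/-- The conditional expectation of `X` given `t X + Z = y`, extended to all times `t` by being
constant outside `[0, 1]`. -/
def mixField (ν : Measure E) (t : ℝ) (y : E) : E := mixMean ν (projIcc 0 1 zero_le_one t : ℝ) y

omit [BorelSpace E] [FiniteDimensional ℝ E] [IsProbabilityMeasure ν] in
lemma mixField_of_mem {t : ℝ} (ht : t ∈ Icc (0 : ℝ) 1) (y : E) :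
    mixField ν t y = mixMean ν t y := by
  rw [mixField, projIcc_of_mem _ ht]

lemma isLipschitzField_mixField (hR : ∀ᵐ x ∂ν, ‖x‖ ≤ R) :
    IsLipschitzField (mixField ν) (4 * R ^ 2) R where
  lipschitz t := lipschitzWith_mixMean hR (projIcc 0 1 zero_le_one t).2
  norm_le t y := norm_mixMean_le hR (projIcc 0 1 zero_le_one t).2 y
  continuous := by
    have h : Continuous fun p : E × ℝ => mixField ν p.2 p.1 := by
      refine continuous_prod_of_continuous_lipschitzWith _ (4 * R ^ 2) (fun y => ?_)
        (fun t => lipschitzWith_mixMean hR (projIcc 0 1 zero_le_one t).2)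
      have hw : ∀ x : E, Continuous fun t : ℝ =>
          tiltWeight (projIcc 0 1 zero_le_one t : ℝ) x y := fun x => by
        have := continuous_subtype_val.comp (continuous_projIcc (h := zero_le_one' ℝ))
        exact continuous_tiltWeight.comp (this.prodMk (continuous_const (y := (x, y))))
      have hD : Continuous fun t : ℝ => mixDensity ν (projIcc 0 1 zero_le_one t : ℝ) y := by
        refine continuous_of_dominated
          (fun t => (measurable_tiltWeight _ y).aestronglyMeasurable)
          (bound := fun _ => rexp (R * ‖y‖)) (fun t => ?_) (integrable_const _)
          (ae_of_all _ hw)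
        filter_upwards [hR] with x hx
        rw [Real.norm_of_nonneg (tiltWeight_pos _ _ _).le]
        exact tiltWeight_le (projIcc 0 1 zero_le_one t).2 hx y
      have hN : Continuous fun t : ℝ => mixMoment ν (projIcc 0 1 zero_le_one t : ℝ) y := by
        refine continuous_of_dominated
          (fun t => ((measurable_tiltWeight _ y).smul measurable_id).aestronglyMeasurable)
          (bound := fun _ => rexp (R * ‖y‖) * R) (fun t => ?_) (integrable_const _)
          (ae_of_all _ fun x => (hw x).smul continuous_const)
        filter_upwards [hR] with x hx
        rw [norm_smul, Real.norm_of_nonneg (tiltWeight_pos _ _ _).le]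
        exact mul_le_mul (tiltWeight_le (projIcc 0 1 zero_le_one t).2 hx y) hx (norm_nonneg _)
          (Real.exp_nonneg _)
      exact (hD.inv₀ fun t => (mixDensity_pos hR (projIcc 0 1 zero_le_one t).2 y).ne').smul hN
    exact h.comp continuous_swap

lemma measurable_uncurry_tiltWeight (t : ℝ) : Measurable fun p : E × E => tiltWeight t p.1 p.2 :=
  (continuous_tiltWeight.comp (Continuous.prodMk_right t)).measurable

/-- Shifting the Gaussian coordinate by `t` times the first one amounts to tilting by
`tiltWeight`. -/
lemma map_shear_eq_withDensity (ν : Measure E) [IsProbabilityMeasure ν] (t : ℝ) :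
    (ν.prod (ProbabilityTheory.stdGaussian E)).map (fun p => (p.1, t • p.1 + p.2)) =
      (ν.prod (ProbabilityTheory.stdGaussian E)).withDensity
        (fun p => ENNReal.ofReal (tiltWeight t p.1 p.2)) := by
  have hw := (measurable_uncurry_tiltWeight (E := E) t).ennreal_ofReal
  refine Measure.ext_of_lintegral _ fun f hf => ?_
  rw [lintegral_map hf (by fun_prop), lintegral_withDensity_eq_lintegral_mul _ hw hf,
    lintegral_prod _ (by fun_prop), lintegral_prod _ (hw.mul hf).aemeasurable]
  refine lintegral_congr fun x => ?_
  simp only [Pi.mul_apply]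
  rw [lintegral_add_left_stdGaussian (t • x) (f := fun z => f (x, z)) (by fun_prop)]
  refine lintegral_congr fun z => ?_
  rw [tiltWeight, inner_smul_left, norm_smul, mul_pow, Real.norm_eq_abs, sq_abs]
  rfl

lemma map_add_absolutelyContinuous (ν : Measure E) [IsProbabilityMeasure ν] (t : ℝ) :
    (ν.prod (ProbabilityTheory.stdGaussian E)).map (fun p => t • p.1 + p.2) ≪ volume := by
  have h : (ν.prod (ProbabilityTheory.stdGaussian E)).map (fun p => (p.1, t • p.1 + p.2)) ≪
      ν.prod (ProbabilityTheory.stdGaussian E) := by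
    rw [map_shear_eq_withDensity]
    exact withDensity_absolutelyContinuous _ _
  have h2 := h.map (measurable_snd (α := E) (β := E))
  rw [Measure.map_map measurable_snd (by fun_prop), Measure.map_snd_prod, measure_univ,
    one_smul] at h2
  exact h2.trans stdGaussian_absolutelyContinuous

/-- `mixMean ν t` is the conditional expectation of `X` given `t X + Z`. -/
lemma integral_clm_sub_mixMean_eq_zero (hR : ∀ᵐ x ∂ν, ‖x‖ ≤ R) {t : ℝ}
    (ht : t ∈ Icc (0 : ℝ) 1) {F : Type*} [NormedAddCommGroup F] [NormedSpace ℝ F]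
    [CompleteSpace F] [MeasurableSpace F] [BorelSpace F] [SecondCountableTopology F]
    {g : E → E →L[ℝ] F} (hg : Measurable g) {C : ℝ} (hC : ∀ y, ‖g y‖ ≤ C) :
    ∫ p, g (t • p.1 + p.2) (p.1 - mixMean ν t (t • p.1 + p.2))
      ∂(ν.prod (ProbabilityTheory.stdGaussian E)) = 0 := by
  set P := ν.prod (ProbabilityTheory.stdGaussian E)
  have hm : Measurable (mixMean ν t) := (lipschitzWith_mixMean hR ht).continuous.measurable
  have hG : Measurable fun p : E × E => g p.2 (p.1 - mixMean ν t p.2) := by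
    have h1 : Measurable fun p : E × E => g p.2 := by fun_prop
    have h2 : Measurable fun p : E × E => p.1 - mixMean ν t p.2 := by fun_prop
    exact (isBoundedBilinearMap_apply (𝕜 := ℝ) (E := E) (F := F)).continuous.measurable.comp
      (h1.prodMk h2)
  have hsh : Measurable fun p : E × E => (p.1, t • p.1 + p.2) := by fun_prop
  have hw := (measurable_uncurry_tiltWeight (E := E) t).ennreal_ofReal
  have hRP : ∀ᵐ p ∂P, ‖p.1‖ ≤ R := Measure.quasiMeasurePreserving_fst.ae hR
  have hi : Integrable (fun p : E × E => g p.2 (p.1 - mixMean ν t p.2))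
      (P.map (fun p => (p.1, t • p.1 + p.2))) := by
    have := Measure.isProbabilityMeasure_map (μ := P) hsh.aemeasurable
    refine Integrable.of_bound hG.aestronglyMeasurable (C * (2 * R)) ?_
    rw [ae_map_iff hsh.aemeasurable (measurableSet_le hG.norm measurable_const)]
    filter_upwards [hRP] with p hp
    refine (ContinuousLinearMap.le_opNorm _ _).trans ?_
    refine mul_le_mul (hC _) ((norm_sub_le _ _).trans ?_) (norm_nonneg _)
      ((norm_nonneg _).trans (hC 0))
    linarith [norm_mixMean_le hR ht (t • p.1 + p.2)]
  rw [← integral_map (φ := fun p : E × E => (p.1, t • p.1 + p.2)) hsh.aemeasurable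
    (f := fun p => g p.2 (p.1 - mixMean ν t p.2)) hG.aestronglyMeasurable]
  rw [map_shear_eq_withDensity, integrable_withDensity_iff_integrable_smul' hw
    (ae_of_all _ fun _ => ENNReal.ofReal_lt_top)] at hi
  rw [map_shear_eq_withDensity, integral_withDensity_eq_integral_toReal_smul hw
    (ae_of_all _ fun _ => ENNReal.ofReal_lt_top), integral_prod_symm _ hi]
  refine integral_eq_zero_of_ae (ae_of_all _ fun z => ?_)
  have hiz : Integrable (fun x => tiltWeight t x z • x - tiltWeight t x z • mixMean ν t z) ν :=
    (integrable_tiltWeight_smul hR ht z).sub ((integrable_tiltWeight hR ht z).smul_const _)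
  have hrew : ∀ x, (ENNReal.ofReal (tiltWeight t x z)).toReal • g z (x - mixMean ν t z) =
      g z (tiltWeight t x z • x - tiltWeight t x z • mixMean ν t z) := fun x => by
    rw [ENNReal.toReal_ofReal (tiltWeight_pos _ _ _).le, ← smul_sub, map_smul]
  simp only [hrew]
  rw [ContinuousLinearMap.integral_comp_comm _ hiz, integral_sub
    (integrable_tiltWeight_smul hR ht z) ((integrable_tiltWeight hR ht z).smul_const _),
    integral_smul_const]
  change g z (mixMoment ν t z - mixDensity ν t z • mixMean ν t z) = 0
  rw [mixDensity_smul_mixMean hR ht, sub_self, map_zero]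

lemma one_sub_le_mixDensity (hR : ∀ᵐ x ∂ν, ‖x‖ ≤ R) (h0 : ∫ x, x ∂ν = 0) {t : ℝ}
    (ht : t ∈ Icc (0 : ℝ) 1) (y : E) : 1 - (∫ x, ‖x‖ ^ 2 ∂ν) / 2 ≤ mixDensity ν t y := by
  have hi1 := integrable_id_of_bound hR
  have hi2 : Integrable (fun x => ‖x‖ ^ 2) ν := by
    refine Integrable.of_bound (by fun_prop) ((R : ℝ) ^ 2) ?_
    filter_upwards [hR] with x hx
    rw [Real.norm_of_nonneg (by positivity)]
    gcongr
  have hi3 : Integrable (fun x => t * ⟪x, y⟫) ν := (hi1.inner_const y).const_mul t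
  have hi4 : Integrable (fun x => 1 + t * ⟪x, y⟫) ν := (integrable_const _).add hi3
  have hz : ∫ x, t * ⟪x, y⟫ ∂ν = 0 := by
    rw [integral_const_mul]
    simp_rw [real_inner_comm]
    rw [integral_inner hi1, h0, inner_zero_right, mul_zero]
  calc 1 - (∫ x, ‖x‖ ^ 2 ∂ν) / 2 = ∫ x, (1 + t * ⟪x, y⟫) - ‖x‖ ^ 2 / 2 ∂ν := by
        rw [integral_sub hi4 (hi2.div_const 2), integral_add (integrable_const _) hi3, hz,
          integral_div]
        simp
    _ ≤ mixDensity ν t y := by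
        refine integral_mono (hi4.sub (hi2.div_const 2))
          (integrable_tiltWeight hR ht y) fun x => ?_
        have h1 := Real.add_one_le_exp (t * ⟪x, y⟫ - t ^ 2 * ‖x‖ ^ 2 / 2)
        have h2 : t ^ 2 * ‖x‖ ^ 2 ≤ ‖x‖ ^ 2 :=
          mul_le_of_le_one_left (by positivity) (pow_le_one₀ ht.1 ht.2)
        simp only [tiltWeight]
        linarith

lemma lintegral_tiltWeight_mul (t : ℝ) (x x' : E) :
    ∫⁻ z, ENNReal.ofReal (tiltWeight t x z * tiltWeight t x' z) ∂ProbabilityTheory.stdGaussian E =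
      ENNReal.ofReal (rexp (t ^ 2 * ⟪x, x'⟫)) := by
  have h : ∀ z, ENNReal.ofReal (tiltWeight t x z * tiltWeight t x' z) =
      ENNReal.ofReal (rexp (-(t ^ 2 * (‖x‖ ^ 2 + ‖x'‖ ^ 2) / 2))) *
        ENNReal.ofReal (rexp ⟪t • (x + x'), z⟫) := fun z => by
    rw [← ENNReal.ofReal_mul (by positivity), tiltWeight, tiltWeight, ← Real.exp_add,
      ← Real.exp_add, real_inner_smul_left, inner_add_left]
    congr 2; ring
  simp_rw [h]
  rw [lintegral_const_mul _ (by fun_prop), lintegral_exp_inner_stdGaussian,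
    ← ENNReal.ofReal_mul (by positivity), ← Real.exp_add, norm_smul, mul_pow, Real.norm_eq_abs,
    sq_abs, norm_add_sq_real]
  congr 2; ring

lemma integrable_tiltWeight_mul (t : ℝ) (x x' : E) :
    Integrable (fun z => tiltWeight t x z * tiltWeight t x' z)
      (ProbabilityTheory.stdGaussian E) := by
  refine ⟨Measurable.aestronglyMeasurable (by unfold tiltWeight; fun_prop), ?_⟩
  rw [hasFiniteIntegral_iff_ofReal
    (ae_of_all _ fun z => (mul_pos (tiltWeight_pos t x z) (tiltWeight_pos t x' z)).le),
    lintegral_tiltWeight_mul]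
  exact ENNReal.ofReal_lt_top

lemma integral_tiltWeight_mul (t : ℝ) (x x' : E) :
    ∫ z, tiltWeight t x z * tiltWeight t x' z ∂ProbabilityTheory.stdGaussian E =
      rexp (t ^ 2 * ⟪x, x'⟫) := by
  rw [integral_eq_lintegral_of_nonneg_ae
    (ae_of_all _ fun z => (mul_pos (tiltWeight_pos t x z) (tiltWeight_pos t x' z)).le)
    (integrable_tiltWeight_mul t x x').1, lintegral_tiltWeight_mul,
    ENNReal.toReal_ofReal (Real.exp_nonneg _)]

omit [MeasurableSpace E] [BorelSpace E] [FiniteDimensional ℝ E] in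
lemma abs_inner_le_of_norm_le {x x' : E} (hx : ‖x‖ ≤ R) (hx' : ‖x'‖ ≤ R) :
    |⟪x, x'⟫| ≤ (R : ℝ) ^ 2 := by
  rw [sq]
  exact (abs_real_inner_le_norm _ _).trans (mul_le_mul hx hx' (norm_nonneg _) R.2)

omit [InnerProductSpace ℝ E] [BorelSpace E] [FiniteDimensional ℝ E] [IsProbabilityMeasure ν] in
lemma ae_prod_norm_le (hR : ∀ᵐ x ∂ν, ‖x‖ ≤ R) :
    ∀ᵐ q ∂(ν.prod ν), ‖q.1‖ ≤ R ∧ ‖q.2‖ ≤ R :=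
  (Measure.quasiMeasurePreserving_fst.ae hR).and (Measure.quasiMeasurePreserving_snd.ae hR)

lemma integral_tiltWeight_mul_inner (hR : ∀ᵐ x ∂ν, ‖x‖ ≤ R) {t : ℝ}
    (ht : t ∈ Icc (0 : ℝ) 1) (z : E) :
    ∫ q : E × E, tiltWeight t q.1 z * tiltWeight t q.2 z * ⟪q.1, q.2⟫ ∂(ν.prod ν) =
      ‖mixMoment ν t z‖ ^ 2 := by
  have hi : Integrable
      (fun q : E × E => tiltWeight t q.1 z * tiltWeight t q.2 z * ⟪q.1, q.2⟫) (ν.prod ν) := by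
    refine Integrable.of_bound (Measurable.aestronglyMeasurable (by unfold tiltWeight; fun_prop))
      (rexp (R * ‖z‖) * rexp (R * ‖z‖) * (R : ℝ) ^ 2) ?_
    filter_upwards [ae_prod_norm_le hR] with q hq
    rw [norm_mul, norm_mul, Real.norm_of_nonneg (tiltWeight_pos _ _ _).le,
      Real.norm_of_nonneg (tiltWeight_pos _ _ _).le]
    have h1 := tiltWeight_le ht hq.1 z
    have h2 := tiltWeight_le ht hq.2 z
    have h3 := abs_inner_le_of_norm_le hq.1 hq.2
    have h4 := (tiltWeight_pos t q.2 z).le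
    gcongr
    exact h3
  have hN := integrable_tiltWeight_smul hR ht z
  rw [integral_prod _ hi, ← real_inner_self_eq_norm_sq]
  have hin : ∀ w : E, ⟪w, mixMoment ν t z⟫ = ∫ x, ⟪w, tiltWeight t x z • x⟫ ∂ν :=
    fun w => (integral_inner hN w).symm
  rw [hin]
  refine integral_congr_ae (ae_of_all _ fun x => ?_)
  simp only
  rw [real_inner_comm, hin]
  refine integral_congr_ae (ae_of_all _ fun x' => ?_)
  simp only [real_inner_smul_left, real_inner_smul_right]
  ring

lemma integrable_tiltWeight_mul_inner (hR : ∀ᵐ x ∂ν, ‖x‖ ≤ R) {t : ℝ}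
    (ht : t ∈ Icc (0 : ℝ) 1) :
    Integrable (fun p : (E × E) × E => tiltWeight t p.1.1 p.2 * tiltWeight t p.1.2 p.2 *
      ⟪p.1.1, p.1.2⟫) ((ν.prod ν).prod (ProbabilityTheory.stdGaussian E)) := by
  rw [integrable_prod_iff
    (Measurable.aestronglyMeasurable (by unfold tiltWeight; fun_prop))]
  refine ⟨ae_of_all _ fun q => (integrable_tiltWeight_mul t q.1 q.2).mul_const ⟪q.1, q.2⟫, ?_⟩
  have h : ∀ q : E × E, ∫ z, ‖tiltWeight t q.1 z * tiltWeight t q.2 z * ⟪q.1, q.2⟫‖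
      ∂ProbabilityTheory.stdGaussian E = rexp (t ^ 2 * ⟪q.1, q.2⟫) * |⟪q.1, q.2⟫| := fun q => by
    simp_rw [norm_mul, Real.norm_of_nonneg (tiltWeight_pos _ _ _).le, Real.norm_eq_abs]
    rw [integral_mul_const, integral_tiltWeight_mul]
  simp only [h]
  refine Integrable.of_bound (Measurable.aestronglyMeasurable (by fun_prop))
    (rexp ((R : ℝ) ^ 2) * (R : ℝ) ^ 2) ?_
  filter_upwards [ae_prod_norm_le hR] with q hq
  have h3 := abs_inner_le_of_norm_le hq.1 hq.2
  have h4 : t ^ 2 * ⟪q.1, q.2⟫ ≤ (R : ℝ) ^ 2 := by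
    have := pow_le_one₀ ht.1 ht.2 (n := 2)
    nlinarith [le_abs_self ⟪q.1, q.2⟫, sq_nonneg t, sq_nonneg (R : ℝ)]
  rw [norm_mul, Real.norm_of_nonneg (Real.exp_nonneg _), Real.norm_eq_abs, abs_abs]
  gcongr

/-- `r (e^{a r} - 1) ≤ e^{b} r²` for `a ≤ 1` and `a r ≤ b`. -/
lemma mul_exp_sub_one_le {a r b : ℝ} (ha : a ≤ 1) (hb0 : 0 ≤ b) (hb : a * r ≤ b) :
    r * (rexp (a * r) - 1) ≤ rexp b * r ^ 2 := by
  have hb1 : 1 ≤ rexp b := Real.one_le_exp hb0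
  rcases le_total 0 r with hr | hr
  · have h1 : rexp (a * r) - 1 ≤ a * r * rexp (a * r) := by
      have := Real.add_one_le_exp (-(a * r))
      have h2 : rexp (a * r) * rexp (-(a * r)) = 1 := by rw [← Real.exp_add]; simp
      nlinarith [Real.exp_pos (a * r)]
    have h3 : a * r * rexp (a * r) ≤ r * rexp b := by
      refine mul_le_mul (by nlinarith) (Real.exp_le_exp.2 hb) (Real.exp_nonneg _) hr
    nlinarith
  · have h1 := Real.add_one_le_exp (a * r)
    have h2 : r * (rexp (a * r) - 1) ≤ r * (a * r) :=
      mul_le_mul_of_nonpos_left (by linarith) hr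
    nlinarith [sq_nonneg r]

lemma integral_exp_inner_mul_inner_le (hR : ∀ᵐ x ∂ν, ‖x‖ ≤ R) (h0 : ∫ x, x ∂ν = 0) {t : ℝ}
    (ht : t ∈ Icc (0 : ℝ) 1) :
    ∫ q : E × E, rexp (t ^ 2 * ⟪q.1, q.2⟫) * ⟪q.1, q.2⟫ ∂(ν.prod ν) ≤
      rexp ((R : ℝ) ^ 2) * (∫ x, ‖x‖ ^ 2 ∂ν) ^ 2 := by
  have hae := ae_prod_norm_le hR
  have ht2 := pow_le_one₀ ht.1 ht.2 (n := 2)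
  have h4 : ∀ q : E × E, ‖q.1‖ ≤ R ∧ ‖q.2‖ ≤ R → t ^ 2 * ⟪q.1, q.2⟫ ≤ (R : ℝ) ^ 2 := fun q hq => by
    have := abs_inner_le_of_norm_le hq.1 hq.2
    nlinarith [le_abs_self ⟪q.1, q.2⟫, sq_nonneg t, sq_nonneg (R : ℝ)]
  have hi1 : Integrable (fun q : E × E => ⟪q.1, q.2⟫) (ν.prod ν) := by
    refine Integrable.of_bound (Measurable.aestronglyMeasurable (by fun_prop)) ((R : ℝ) ^ 2) ?_
    filter_upwards [hae] with q hq using abs_inner_le_of_norm_le hq.1 hq.2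
  have hi2 : Integrable (fun q : E × E => rexp (t ^ 2 * ⟪q.1, q.2⟫) * ⟪q.1, q.2⟫) (ν.prod ν) := by
    refine Integrable.of_bound (Measurable.aestronglyMeasurable (by fun_prop))
      (rexp ((R : ℝ) ^ 2) * (R : ℝ) ^ 2) ?_
    filter_upwards [hae] with q hq
    rw [norm_mul, Real.norm_of_nonneg (Real.exp_nonneg _), Real.norm_eq_abs]
    have h3 := abs_inner_le_of_norm_le hq.1 hq.2
    have h5 := h4 q hq
    gcongr
  have hi3 : Integrable (fun x => ‖x‖ ^ 2) ν := by
    refine Integrable.of_bound (by fun_prop) ((R : ℝ) ^ 2) ?_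
    filter_upwards [hR] with x hx
    rw [Real.norm_of_nonneg (by positivity)]
    gcongr
  have hz : ∫ q : E × E, ⟪q.1, q.2⟫ ∂(ν.prod ν) = 0 := by
    rw [integral_prod _ hi1]
    refine integral_eq_zero_of_ae (ae_of_all _ fun x => ?_)
    simp only [Pi.zero_apply]
    rw [integral_inner (integrable_id_of_bound hR), h0, inner_zero_right]
  calc ∫ q : E × E, rexp (t ^ 2 * ⟪q.1, q.2⟫) * ⟪q.1, q.2⟫ ∂(ν.prod ν)
      = ∫ q : E × E, rexp (t ^ 2 * ⟪q.1, q.2⟫) * ⟪q.1, q.2⟫ - ⟪q.1, q.2⟫ ∂(ν.prod ν) := by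
        rw [integral_sub hi2 hi1, hz, sub_zero]
    _ ≤ ∫ q : E × E, rexp ((R : ℝ) ^ 2) * (‖q.1‖ ^ 2 * ‖q.2‖ ^ 2) ∂(ν.prod ν) := by
        refine integral_mono_ae (hi2.sub hi1) ((hi3.mul_prod hi3).const_mul _) ?_
        filter_upwards [hae] with q hq
        have h1 := mul_exp_sub_one_le ht2 (sq_nonneg (R : ℝ)) (h4 q hq)
        have h2 : ⟪q.1, q.2⟫ ^ 2 ≤ ‖q.1‖ ^ 2 * ‖q.2‖ ^ 2 := by
          rw [← mul_pow, ← sq_abs]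
          gcongr
          exact abs_real_inner_le_norm _ _
        have h3 := mul_le_mul_of_nonneg_left h2 (Real.exp_nonneg ((R : ℝ) ^ 2))
        linarith
    _ = rexp ((R : ℝ) ^ 2) * (∫ x, ‖x‖ ^ 2 ∂ν) ^ 2 := by
        rw [integral_const_mul, integral_prod_mul (fun x : E => ‖x‖ ^ 2) (fun x : E => ‖x‖ ^ 2)]
        ring

/-- The second moment of the conditional expectation of `X` given `t X + Z` is of the order of the
fourth power of the standard deviation of `X`. -/
lemma lintegral_norm_mixMean_sq_le (hR : ∀ᵐ x ∂ν, ‖x‖ ≤ R) (h0 : ∫ x, x ∂ν = 0)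
    (h2 : ∫ x, ‖x‖ ^ 2 ∂ν < 2) {t : ℝ} (ht : t ∈ Icc (0 : ℝ) 1) :
    ∫⁻ p, ENNReal.ofReal (‖mixMean ν t (t • p.1 + p.2)‖ ^ 2)
      ∂(ν.prod (ProbabilityTheory.stdGaussian E)) ≤
    ENNReal.ofReal (rexp ((R : ℝ) ^ 2) * (∫ x, ‖x‖ ^ 2 ∂ν) ^ 2 / (1 - (∫ x, ‖x‖ ^ 2 ∂ν) / 2)) := by
  set a := ∫ x, ‖x‖ ^ 2 ∂ν
  have ha : 0 < 1 - a / 2 := by linarith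
  have hm : Measurable (mixMean ν t) := (lipschitzWith_mixMean hR ht).continuous.measurable
  have hsq : Measurable fun y => ENNReal.ofReal (‖mixMean ν t y‖ ^ 2) := by fun_prop
  have hw := (measurable_uncurry_tiltWeight (E := E) t).ennreal_ofReal
  have hF := integrable_tiltWeight_mul_inner hR ht
  have hNi : Integrable (fun z => ‖mixMoment ν t z‖ ^ 2) (ProbabilityTheory.stdGaussian E) :=
    hF.integral_prod_right.congr
      (ae_of_all _ fun z => integral_tiltWeight_mul_inner hR ht z)
  have hN : ∫ z, ‖mixMoment ν t z‖ ^ 2 ∂ProbabilityTheory.stdGaussian E ≤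
      rexp ((R : ℝ) ^ 2) * a ^ 2 := by
    simp_rw [← integral_tiltWeight_mul_inner hR ht]
    rw [← integral_integral_swap hF]
    simp_rw [integral_mul_const, integral_tiltWeight_mul]
    exact integral_exp_inner_mul_inner_le hR h0 ht
  have hD : ∀ z, ∫⁻ x, ENNReal.ofReal (tiltWeight t x z) ∂ν = ENNReal.ofReal (mixDensity ν t z) :=
    fun z => (ofReal_integral_eq_lintegral_ofReal (integrable_tiltWeight hR ht z)
      (ae_of_all _ fun x => (tiltWeight_pos t x z).le)).symm
  calc ∫⁻ p, ENNReal.ofReal (‖mixMean ν t (t • p.1 + p.2)‖ ^ 2)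
        ∂(ν.prod (ProbabilityTheory.stdGaussian E))
      = ∫⁻ p, ENNReal.ofReal (‖mixMean ν t p.2‖ ^ 2)
        ∂((ν.prod (ProbabilityTheory.stdGaussian E)).map (fun p => (p.1, t • p.1 + p.2))) := by
        rw [lintegral_map (f := fun p : E × E => ENNReal.ofReal (‖mixMean ν t p.2‖ ^ 2))
          (by fun_prop) (by fun_prop)]
    _ = ∫⁻ z, ENNReal.ofReal (mixDensity ν t z) * ENNReal.ofReal (‖mixMean ν t z‖ ^ 2)
        ∂ProbabilityTheory.stdGaussian E := by
        rw [map_shear_eq_withDensity, lintegral_withDensity_eq_lintegral_mul _ hw (by fun_prop),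
          lintegral_prod_symm _ (hw.mul (by fun_prop)).aemeasurable]
        refine lintegral_congr fun z => ?_
        simp only [Pi.mul_apply]
        rw [lintegral_mul_const _ (measurable_tiltWeight t z).ennreal_ofReal, hD]
    _ ≤ ∫⁻ z, ENNReal.ofReal (‖mixMoment ν t z‖ ^ 2 / (1 - a / 2))
        ∂ProbabilityTheory.stdGaussian E := by
        refine lintegral_mono fun z => ?_
        have hDz := one_sub_le_mixDensity hR h0 ht z
        have hDpos := mixDensity_pos hR ht z
        rw [← ENNReal.ofReal_mul hDpos.le]
        refine ENNReal.ofReal_le_ofReal ?_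
        rw [le_div_iff₀ ha, ← mixDensity_smul_mixMean hR ht, norm_smul, mul_pow,
          Real.norm_of_nonneg hDpos.le, sq (mixDensity ν t z)]
        have := mul_le_mul_of_nonneg_left hDz
          (mul_nonneg hDpos.le (sq_nonneg ‖mixMean ν t z‖))
        linarith
    _ ≤ ENNReal.ofReal (rexp ((R : ℝ) ^ 2) * a ^ 2 / (1 - a / 2)) := by
        rw [← ofReal_integral_eq_lintegral_ofReal (hNi.div_const _)
          (ae_of_all _ fun z => by positivity), integral_div]
        exact ENNReal.ofReal_le_ofReal (div_le_div_of_nonneg_right hN ha.le)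

lemma sq_lintegral_le {α : Type*} [MeasurableSpace α] {Q : Measure α} [IsProbabilityMeasure Q]
    {F : Type*} [NormedAddCommGroup F] {f : α → F} (hf : AEStronglyMeasurable f Q) :
    (∫⁻ a, ‖f a‖ₑ ∂Q) ^ 2 ≤ ∫⁻ a, ‖f a‖ₑ ^ 2 ∂Q := by
  have h := eLpNorm_le_eLpNorm_of_exponent_le (p := 1) (q := ((2 : ℝ≥0) : ℝ≥0∞)) (by norm_num) hf
  have h2 := eLpNorm_nnreal_pow_eq_lintegral (f := f) (μ := Q) (p := 2) two_ne_zero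
  rw [eLpNorm_one_eq_lintegral_enorm] at h
  simp only [NNReal.coe_ofNat, ENNReal.rpow_ofNat] at h2
  rw [← h2]
  gcongr

omit [MeasurableSpace E] [BorelSpace E] [FiniteDimensional ℝ E] in
/-- The flow map as a jointly continuous function, with time clamped to `[0, 1]`. -/
lemma IsFlowOf.continuous_uncurry {v : ℝ → E → E} {K : ℝ≥0} {A : ℝ → E → ℝ → E}
    (hA : IsFlowOf A v) (hv : IsLipschitzField v K R) :
    Continuous fun p : E × ℝ => A 1 p.1 (projIcc 0 1 zero_le_one p.2 : ℝ) := by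
  refine continuous_prod_of_continuous_lipschitzWith _ (Real.toNNReal (rexp K)) (fun y => ?_)
    fun t => ?_
  · have h : ContinuousOn (A 1 y) (Icc 0 1) := fun t ht =>
      (hA.hasDeriv 1 ⟨zero_le_one, le_rfl⟩ y t ht).continuousWithinAt
    exact h.comp_continuous (continuous_subtype_val.comp continuous_projIcc)
      fun t => (projIcc 0 1 zero_le_one t).2
  · exact hA.lipschitzWith hv (projIcc 0 1 zero_le_one t).2.1 (projIcc 0 1 zero_le_one t).2.2 le_rfl

omit [MeasurableSpace E] [BorelSpace E] in
lemma IsFlowOf.enorm_sub_sq_le {v : ℝ → E → E} {K : ℝ≥0} {A : ℝ → E → ℝ → E}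
    (hA : IsFlowOf A v) (hv : IsLipschitzField v K R) (y : E) :
    ‖y - A 1 y 0‖ₑ ^ 2 ≤ ∫⁻ s in Ioc (0 : ℝ) 1, ‖v s (A 1 y s)‖ₑ ^ 2 := by
  have h1 : (1 : ℝ) ∈ Icc (0 : ℝ) 1 := ⟨zero_le_one, le_rfl⟩
  have hc : ContinuousOn (A 1 y) (Icc 0 1) := fun t ht =>
    (hA.hasDeriv 1 h1 y t ht).continuousWithinAt
  have hvc : ContinuousOn (fun s => v s (A 1 y s)) (Icc 0 1) :=
    hv.continuous.comp_continuousOn (continuousOn_id.prodMk hc)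
  have hvel : ∫ s in (0 : ℝ)..1, v s (A 1 y s) = y - A 1 y 0 := by
    rw [intervalIntegral.integral_eq_sub_of_hasDerivAt_of_le zero_le_one hc (fun s hs =>
      (hA.hasDeriv 1 h1 y s (Ioo_subset_Icc_self hs)).hasDerivAt (Icc_mem_nhds hs.1 hs.2))
      (hvc.intervalIntegrable_of_Icc zero_le_one), hA.self 1 h1]
  have hprob : IsProbabilityMeasure (volume.restrict (Ioc (0 : ℝ) 1)) := ⟨by simp⟩
  rw [← hvel, intervalIntegral.integral_of_le zero_le_one]
  refine (pow_le_pow_left₀ zero_le (enorm_integral_le_lintegral_enorm _) 2).trans ?_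
  exact sq_lintegral_le ((hvc.mono Ioc_subset_Icc_self).aestronglyMeasurable measurableSet_Ioc)

/-- A bounded centred random vector `X ∼ ν` of small variance: the law of `X + Z` is transported to
the standard Gaussian measure at a cost of the order of the fourth power of the standard deviation
of `X`. -/
lemma exists_transport_to_stdGaussian (hR : ∀ᵐ x ∂ν, ‖x‖ ≤ R) (h0 : ∫ x, x ∂ν = 0)
    (h2 : ∫ x, ‖x‖ ^ 2 ∂ν < 2) :
    ∃ Φ : E → E, Measurable Φ ∧
      (ν.prod (ProbabilityTheory.stdGaussian E)).map (fun p => Φ (p.1 + p.2)) =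
        ProbabilityTheory.stdGaussian E ∧
      ∫⁻ p, ‖p.1 + p.2 - Φ (p.1 + p.2)‖ₑ ^ 2 ∂(ν.prod (ProbabilityTheory.stdGaussian E)) ≤
        ENNReal.ofReal
          (rexp ((R : ℝ) ^ 2) * (∫ x, ‖x‖ ^ 2 ∂ν) ^ 2 / (1 - (∫ x, ‖x‖ ^ 2 ∂ν) / 2)) := by
  set P := ν.prod (ProbabilityTheory.stdGaussian E)
  have hv := isLipschitzField_mixField hR
  obtain ⟨A, hA⟩ := hv.exists_flow
  have hlaw : ∀ t ∈ Icc (0 : ℝ) 1, P.map (fun p => A 1 (p.1 + p.2) t) =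
      P.map (fun p => t • p.1 + p.2) := fun t ht => by
    have := map_flow_eq (P := P) hA hv measurable_fst measurable_snd
      (Measure.quasiMeasurePreserving_fst.ae hR)
      (fun s _ => map_add_absolutelyContinuous ν s)
      (fun s hs g hg ⟨C, hC⟩ => by
        simp_rw [mixField_of_mem hs]
        exact integral_clm_sub_mixMean_eq_zero hR hs hg hC) ht.1 ht.2 le_rfl
    simpa only [one_smul] using this
  have hΦ : Measurable fun y => A 1 y 0 :=
    (hA.lipschitzWith hv le_rfl zero_le_one le_rfl).continuous.measurable
  refine ⟨fun y => A 1 y 0, hΦ, ?_, ?_⟩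
  · rw [hlaw 0 ⟨le_rfl, zero_le_one⟩]
    simp only [zero_smul, zero_add]
    exact Measure.map_snd_prod.trans (by simp)
  have hjoint : Measurable fun q : (E × E) × ℝ =>
      ‖mixField ν q.2 (A 1 (q.1.1 + q.1.2) (projIcc 0 1 zero_le_one q.2 : ℝ))‖ₑ ^ 2 := by
    have h1 : Continuous fun q : (E × E) × ℝ =>
        A 1 (q.1.1 + q.1.2) (projIcc 0 1 zero_le_one q.2 : ℝ) :=
      (hA.continuous_uncurry hv).comp
        (f := fun q : (E × E) × ℝ => (q.1.1 + q.1.2, q.2)) (by fun_prop)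
    have h3 := hv.continuous.comp (continuous_snd.prodMk h1)
    exact h3.measurable.enorm.pow_const 2
  set B := ENNReal.ofReal
    (rexp ((R : ℝ) ^ 2) * (∫ x, ‖x‖ ^ 2 ∂ν) ^ 2 / (1 - (∫ x, ‖x‖ ^ 2 ∂ν) / 2))
  calc ∫⁻ p, ‖p.1 + p.2 - A 1 (p.1 + p.2) 0‖ₑ ^ 2 ∂P
      ≤ ∫⁻ p, (∫⁻ s in Ioc (0 : ℝ) 1,
          ‖mixField ν s (A 1 (p.1 + p.2) (projIcc 0 1 zero_le_one s : ℝ))‖ₑ ^ 2) ∂P := by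
        refine lintegral_mono fun p => (hA.enorm_sub_sq_le hv (p.1 + p.2)).trans_eq ?_
        refine setLIntegral_congr_fun measurableSet_Ioc fun s hs => ?_
        simp only [projIcc_of_mem zero_le_one (Ioc_subset_Icc_self hs)]
    _ = ∫⁻ s in Ioc (0 : ℝ) 1, ∫⁻ p,
          ‖mixField ν s (A 1 (p.1 + p.2) (projIcc 0 1 zero_le_one s : ℝ))‖ₑ ^ 2 ∂P :=
        lintegral_lintegral_swap hjoint.aemeasurable
    _ ≤ ∫⁻ _ in Ioc (0 : ℝ) 1, B := by
        refine setLIntegral_mono' measurableSet_Ioc fun s hs => ?_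
        have hs' := Ioc_subset_Icc_self hs
        have hm : Measurable fun y => ‖mixMean ν s y‖ₑ ^ 2 :=
          (lipschitzWith_mixMean hR hs').continuous.measurable.enorm.pow_const 2
        have hAm : Measurable fun p : E × E => A 1 (p.1 + p.2) s :=
          (hA.lipschitzWith hv hs'.1 hs'.2 le_rfl).continuous.measurable.comp (by fun_prop)
        simp_rw [projIcc_of_mem zero_le_one hs', mixField_of_mem hs']
        rw [← lintegral_map hm hAm, hlaw s hs', lintegral_map hm (by fun_prop)]
        refine le_trans (le_of_eq ?_) (lintegral_norm_mixMean_sq_le hR h0 h2 hs')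
        refine lintegral_congr fun p => ?_
        rw [ENNReal.ofReal_pow (norm_nonneg _), ofReal_norm]
    _ = B := by simp

end GaussianMixture
section Coupling

open Set
open scoped NNReal

lemma stdGaussian_eq_stdGaussian (d : ℕ) :
    _root_.stdGaussian d = ProbabilityTheory.stdGaussian (EuclideanSpace ℝ (Fin d)) :=
  map_pi_eq_stdGaussian

lemma Wp_map_le_eLpNorm {E Ω : Type*} [NormedAddCommGroup E] [MeasurableSpace E] [BorelSpace E]
    [SecondCountableTopology E] [MeasurableSpace Ω] {P : Measure Ω} {U V : Ω → E}
    (hU : Measurable U) (hV : Measurable V) {p : ℝ≥0} (hp : p ≠ 0) :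
    Wp p (P.map U) (P.map V) ≤ eLpNorm (fun ω => U ω - V ω) p P := by
  rw [Wp, eLpNorm_nnreal_eq_lintegral hp]
  refine ENNReal.rpow_le_rpow ?_ (by positivity)
  have hmem : (P.map fun ω => (U ω, V ω)) ∈ couplings (P.map U) (P.map V) := by
    refine ⟨?_, ?_⟩
    · rw [Measure.map_map measurable_fst (hU.prodMk hV)]; rfl
    · rw [Measure.map_map measurable_snd (hU.prodMk hV)]; rfl
  refine (iInf₂_le _ hmem).trans_eq ?_
  rw [lintegral_map (by fun_prop) (hU.prodMk hV)]
  refine lintegral_congr fun ω => ?_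
  change ENNReal.ofReal (‖U ω - V ω‖ ^ (p : ℝ)) = _
  rw [← ENNReal.ofReal_rpow_of_nonneg (norm_nonneg _) p.coe_nonneg, ofReal_norm]

lemma eLpNorm_two_le_ofReal_sqrt {α F : Type*} [MeasurableSpace α] {Q : Measure α}
    [NormedAddCommGroup F] {f : α → F} {B : ℝ} (h : ∫⁻ a, ‖f a‖ₑ ^ 2 ∂Q ≤ ENNReal.ofReal B) :
    eLpNorm f 2 Q ≤ ENNReal.ofReal (√B) := by
  have h2 := eLpNorm_nnreal_pow_eq_lintegral (f := f) (μ := Q) (p := 2) two_ne_zero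
  simp only [NNReal.coe_ofNat, ENNReal.rpow_ofNat, ENNReal.coe_ofNat] at h2
  rw [← ENNReal.pow_le_pow_left_iff two_ne_zero, h2, ← ENNReal.ofReal_pow (Real.sqrt_nonneg _)]
  refine h.trans ?_
  rcases le_total 0 B with hB | hB
  · rw [Real.sq_sqrt hB]
  · rw [ENNReal.ofReal_of_nonpos hB]; exact zero_le

lemma lintegral_enorm_sq_eq {α F : Type*} [MeasurableSpace α] {Q : Measure α}
    [NormedAddCommGroup F] {f : α → F} (h : Integrable (fun a => ‖f a‖ ^ 2) Q) :
    ∫⁻ a, ‖f a‖ₑ ^ 2 ∂Q = ENNReal.ofReal (∫ a, ‖f a‖ ^ 2 ∂Q) := by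
  rw [ofReal_integral_eq_lintegral_ofReal h (ae_of_all _ fun a => by positivity)]
  refine lintegral_congr fun a => ?_
  rw [ENNReal.ofReal_pow (norm_nonneg _), ofReal_norm]

lemma eLpNorm_le_eLpNorm_two {α F : Type*} [MeasurableSpace α] {Q : Measure α}
    [IsProbabilityMeasure Q] [NormedAddCommGroup F] {f : α → F} (hf : AEStronglyMeasurable f Q)
    {p : ℝ≥0} (hp : p ≤ 2) : eLpNorm f p Q ≤ eLpNorm f 2 Q :=
  eLpNorm_le_eLpNorm_of_exponent_le (by exact_mod_cast hp) hf

end Coupling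

section Truncation

open Set
open scoped NNReal

variable {d : ℕ} {μ : Measure (EuclideanSpace ℝ (Fin d))} [IsProbabilityMeasure μ]

lemma integrable_id_of_sq (hmom : Integrable (fun x => ‖x‖ ^ 2) μ) : Integrable (fun x => x) μ := by
  refine (hmom.add (integrable_const (1 : ℝ))).mono' measurable_id.aestronglyMeasurable
    (ae_of_all _ fun x => ?_)
  simp only [Pi.add_apply]
  nlinarith [sq_nonneg (‖x‖ - 1), norm_nonneg x]

omit [IsProbabilityMeasure μ] in
lemma measurableSet_norm_le_one :
    MeasurableSet {x : EuclideanSpace ℝ (Fin d) | ‖x‖ ≤ 1} :=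
  measurableSet_le measurable_norm measurable_const

omit [IsProbabilityMeasure μ] in
lemma measurableSet_one_lt_norm :
    MeasurableSet {x : EuclideanSpace ℝ (Fin d) | 1 < ‖x‖} :=
  measurableSet_lt measurable_const measurable_norm

omit [IsProbabilityMeasure μ] in
lemma measurable_truncCentred : Measurable (truncCentred μ) := by
  unfold truncCentred
  exact (Measurable.ite measurableSet_norm_le_one measurable_id measurable_const).sub_const _

lemma tailOne_le (hmom : Integrable (fun x => ‖x‖ ^ 2) μ) : tailOne μ ≤ ∫ x, ‖x‖ ^ 2 ∂μ :=
  calc tailOne μ ≤ ∫ x in {x : EuclideanSpace ℝ (Fin d) | 1 < ‖x‖}, ‖x‖ ^ 2 ∂μ := by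
        refine setIntegral_mono_on (integrable_id_of_sq hmom).norm.integrableOn hmom.integrableOn
          measurableSet_one_lt_norm fun x hx => ?_
        exact le_self_pow₀ (le_of_lt hx) two_ne_zero
    _ ≤ ∫ x, ‖x‖ ^ 2 ∂μ := setIntegral_le_integral hmom (ae_of_all _ fun x => by positivity)

lemma norm_truncMean_le_tailOne (hmean : ∫ x, x ∂μ = 0) (hmom : Integrable (fun x => ‖x‖ ^ 2) μ) :
    ‖truncMean μ‖ ≤ tailOne μ := by
  have h := integral_add_compl measurableSet_norm_le_one (integrable_id_of_sq hmom)
  have hc : {x : EuclideanSpace ℝ (Fin d) | ‖x‖ ≤ 1}ᶜ = {x | 1 < ‖x‖} := by ext; simp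
  rw [hmean, hc] at h
  rw [truncMean, eq_neg_of_add_eq_zero_left h, norm_neg]
  exact norm_integral_le_integral_norm _

lemma norm_truncCentred_le (hmean : ∫ x, x ∂μ = 0) (hmom : Integrable (fun x => ‖x‖ ^ 2) μ)
    (x : EuclideanSpace ℝ (Fin d)) : ‖truncCentred μ x‖ ≤ 1 + ∫ x, ‖x‖ ^ 2 ∂μ := by
  refine (norm_sub_le _ _).trans (add_le_add ?_
    ((norm_truncMean_le_tailOne hmean hmom).trans (tailOne_le hmom)))
  split_ifs with h
  · exact h
  · simp

omit [IsProbabilityMeasure μ] in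
lemma integral_ite_norm_le_one :
    ∫ x, (if ‖x‖ ≤ 1 then x else 0) ∂μ = truncMean μ := by
  rw [truncMean, ← integral_indicator measurableSet_norm_le_one]
  rfl

lemma integrable_ite_norm_le_one :
    Integrable (fun x : EuclideanSpace ℝ (Fin d) => if ‖x‖ ≤ 1 then x else 0) μ := by
  refine Integrable.of_bound (Measurable.ite measurableSet_norm_le_one measurable_id
    measurable_const).aestronglyMeasurable 1 (ae_of_all _ fun x => ?_)
  split_ifs with h
  · exact h
  · simp

lemma integral_truncCentred : ∫ x, truncCentred μ x ∂μ = 0 := by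
  simp only [truncCentred]
  rw [integral_sub integrable_ite_norm_le_one (integrable_const _), integral_ite_norm_le_one]
  simp

lemma integral_norm_truncCentred_sq_le (hmom : Integrable (fun x => ‖x‖ ^ 2) μ) :
    ∫ x, ‖truncCentred μ x‖ ^ 2 ∂μ ≤ ∫ x, ‖x‖ ^ 2 ∂μ := by
  set f : EuclideanSpace ℝ (Fin d) → EuclideanSpace ℝ (Fin d) :=
    fun x => if ‖x‖ ≤ 1 then x else 0 with hf
  have hfi : Integrable f μ := integrable_ite_norm_le_one
  have hfn : ∀ x, ‖f x‖ ^ 2 ≤ ‖x‖ ^ 2 := fun x => by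
    simp only [hf]; split_ifs <;> simp
  have hf2 : Integrable (fun x => ‖f x‖ ^ 2) μ :=
    hmom.mono' (hfi.1.norm.pow 2) (ae_of_all _ fun x => by
      rw [Real.norm_of_nonneg (by positivity)]; exact hfn x)
  have hfin : Integrable (fun x => 2 * ⟪f x, truncMean μ⟫) μ :=
    (hfi.inner_const _).const_mul 2
  have hfin' : Integrable (fun x => ‖f x‖ ^ 2 - 2 * ⟪f x, truncMean μ⟫) μ := hf2.sub hfin
  have hin : ∫ x, 2 * ⟪f x, truncMean μ⟫ ∂μ = 2 * ‖truncMean μ‖ ^ 2 := by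
    rw [integral_const_mul]
    simp_rw [real_inner_comm]
    rw [integral_inner hfi, integral_ite_norm_le_one, real_inner_self_eq_norm_sq]
  calc ∫ x, ‖truncCentred μ x‖ ^ 2 ∂μ
      = ∫ x, ‖f x‖ ^ 2 - 2 * ⟪f x, truncMean μ⟫ + ‖truncMean μ‖ ^ 2 ∂μ :=
        integral_congr_ae (ae_of_all _ fun x => norm_sub_sq_real _ _)
    _ = ∫ x, ‖f x‖ ^ 2 ∂μ - ‖truncMean μ‖ ^ 2 := by
        rw [integral_add hfin' (integrable_const _), integral_sub hf2 hfin, hin]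
        simp
        ring
    _ ≤ ∫ x, ‖f x‖ ^ 2 ∂μ := by linarith [sq_nonneg ‖truncMean μ‖]
    _ ≤ ∫ x, ‖x‖ ^ 2 ∂μ := integral_mono hf2 hmom hfn

omit [IsProbabilityMeasure μ] in
lemma norm_sub_truncCentred_le (x : EuclideanSpace ℝ (Fin d)) :
    ‖x - truncCentred μ x‖ ≤ {x | 1 < ‖x‖}.indicator (fun x => ‖x‖) x + ‖truncMean μ‖ := by
  rw [truncCentred, sub_sub_eq_add_sub, add_sub_right_comm]
  refine (norm_add_le _ _).trans (add_le_add_left ?_ _)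
  by_cases h : ‖x‖ ≤ 1
  · simp [h, not_lt.2 h]
  · simp [h, not_le.1 h]

lemma eLpNorm_one_sub_truncCentred_le (hmean : ∫ x, x ∂μ = 0)
    (hmom : Integrable (fun x => ‖x‖ ^ 2) μ) :
    eLpNorm (fun x => x - truncCentred μ x) 1 μ ≤ ENNReal.ofReal (2 * ∫ x, ‖x‖ ^ 2 ∂μ) := by
  have hi : Integrable
      (fun x => {x | 1 < ‖x‖}.indicator (fun x : EuclideanSpace ℝ (Fin d) => ‖x‖) x) μ :=
    (integrable_id_of_sq hmom).norm.indicator measurableSet_one_lt_norm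
  have hi2 : Integrable (fun x => {x | 1 < ‖x‖}.indicator
      (fun x : EuclideanSpace ℝ (Fin d) => ‖x‖) x + ‖truncMean μ‖) μ :=
    hi.add (integrable_const _)
  rw [eLpNorm_one_eq_lintegral_enorm]
  calc ∫⁻ x, ‖x - truncCentred μ x‖ₑ ∂μ
      ≤ ∫⁻ x, ENNReal.ofReal ({x | 1 < ‖x‖}.indicator
          (fun x : EuclideanSpace ℝ (Fin d) => ‖x‖) x + ‖truncMean μ‖) ∂μ := by
        refine lintegral_mono fun x => ?_
        rw [← ofReal_norm]
        exact ENNReal.ofReal_le_ofReal (norm_sub_truncCentred_le x)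
    _ ≤ ENNReal.ofReal (2 * ∫ x, ‖x‖ ^ 2 ∂μ) := by
        rw [← ofReal_integral_eq_lintegral_ofReal hi2 (ae_of_all _ fun x =>
          (norm_nonneg _).trans (norm_sub_truncCentred_le x)),
          integral_add hi (integrable_const _), integral_indicator measurableSet_one_lt_norm]
        refine ENNReal.ofReal_le_ofReal ?_
        have h1 := norm_truncMean_le_tailOne hmean hmom
        have h2 := tailOne_le hmom
        rw [tailOne] at h1 h2
        simp only [integral_const, probReal_univ, smul_eq_mul, one_mul]
        linarith

lemma sq_integral_norm_sq_le (hmom : Integrable (fun x => ‖x‖ ^ 2) μ)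
    (hmom4 : Integrable (fun x => ‖x‖ ^ 4) μ) :
    (∫ x, ‖x‖ ^ 2 ∂μ) ^ 2 ≤ ∫ x, ‖x‖ ^ 4 ∂μ := by
  set a := ∫ x, ‖x‖ ^ 2 ∂μ with ha
  have h : 0 ≤ ∫ x, (‖x‖ ^ 4 - 2 * a * ‖x‖ ^ 2) + a ^ 2 ∂μ := by
    refine integral_nonneg fun x => ?_
    have : ‖x‖ ^ 4 - 2 * a * ‖x‖ ^ 2 + a ^ 2 = (‖x‖ ^ 2 - a) ^ 2 := by ring
    simp only [this]
    positivity
  rw [integral_add (f := fun x => ‖x‖ ^ 4 - 2 * a * ‖x‖ ^ 2) (hmom4.sub (hmom.const_mul _))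
    (integrable_const _), integral_sub hmom4 (hmom.const_mul _), integral_const_mul, ← ha] at h
  simp only [integral_const, probReal_univ, smul_eq_mul, one_mul] at h
  linarith

lemma eLpNorm_two_sub_truncCentred_le (hmean : ∫ x, x ∂μ = 0)
    (hmom : Integrable (fun x => ‖x‖ ^ 2) μ) (hmom4 : Integrable (fun x => ‖x‖ ^ 4) μ) :
    eLpNorm (fun x => x - truncCentred μ x) 2 μ ≤
      ENNReal.ofReal (2 * √(∫ x, ‖x‖ ^ 4 ∂μ)) := by
  have hsq : 2 * √(∫ x, ‖x‖ ^ 4 ∂μ) = √(4 * ∫ x, ‖x‖ ^ 4 ∂μ) := by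
    rw [Real.sqrt_mul (by norm_num), show (4 : ℝ) = 2 ^ 2 by norm_num, Real.sqrt_sq (by norm_num)]
  rw [hsq]
  have hm : ‖truncMean μ‖ ^ 2 ≤ ∫ x, ‖x‖ ^ 4 ∂μ :=
    (pow_le_pow_left₀ (norm_nonneg _)
      ((norm_truncMean_le_tailOne hmean hmom).trans (tailOne_le hmom)) 2).trans
      (sq_integral_norm_sq_le hmom hmom4)
  have hi : Integrable (fun x => 2 * ‖x‖ ^ 4 + 2 * ‖truncMean μ‖ ^ 2) μ :=
    (hmom4.const_mul 2).add (integrable_const _)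
  refine eLpNorm_two_le_ofReal_sqrt ?_
  calc ∫⁻ x, ‖x - truncCentred μ x‖ₑ ^ 2 ∂μ
      ≤ ∫⁻ x, ENNReal.ofReal (2 * ‖x‖ ^ 4 + 2 * ‖truncMean μ‖ ^ 2) ∂μ := by
        refine lintegral_mono fun x => ?_
        rw [← ofReal_norm, ← ENNReal.ofReal_pow (norm_nonneg _)]
        refine ENNReal.ofReal_le_ofReal ?_
        have h1 := norm_sub_truncCentred_le (μ := μ) x
        set i := {x | 1 < ‖x‖}.indicator (fun x : EuclideanSpace ℝ (Fin d) => ‖x‖) x with hi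
        have h2 : i ^ 2 ≤ ‖x‖ ^ 4 := by
          simp only [hi, indicator_apply, mem_ofPred_eq]
          split_ifs with h
          · exact pow_le_pow_right₀ h.le (by norm_num)
          · rw [zero_pow two_ne_zero]; positivity
        have h3 := pow_le_pow_left₀ (norm_nonneg _) h1 2
        nlinarith [sq_nonneg (i - ‖truncMean μ‖)]
    _ ≤ ENNReal.ofReal (4 * ∫ x, ‖x‖ ^ 4 ∂μ) := by
        rw [← ofReal_integral_eq_lintegral_ofReal hi (ae_of_all _ fun x => by positivity),
          integral_add (hmom4.const_mul 2) (integrable_const _), integral_const_mul]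
        refine ENNReal.ofReal_le_ofReal ?_
        simp only [integral_const, probReal_univ, smul_eq_mul, one_mul]
        linarith

end Truncation

section Main

open Set
open scoped NNReal

variable {d : ℕ} {μ : Measure (EuclideanSpace ℝ (Fin d))} [IsProbabilityMeasure μ]

lemma sqrt_two_mul_cFour_bounds : 2.475 ≤ √(2 * cFour) ∧ √(2 * cFour) ≤ 3 := by
  have h1 : rexp 4 = rexp 1 ^ 4 := by rw [← Real.exp_nat_mul]; norm_num
  have hl : (2.718 : ℝ) ^ 4 ≤ rexp 1 ^ 4 :=
    pow_le_pow_left₀ (by norm_num) (by linarith [Real.exp_one_gt_d9]) 4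
  have hu : rexp 1 ^ 4 ≤ (2.719 : ℝ) ^ 4 :=
    pow_le_pow_left₀ (Real.exp_nonneg _) (by linarith [Real.exp_one_lt_d9]) 4
  constructor
  · refine Real.le_sqrt_of_sq_le ?_
    rw [cFour, h1]
    norm_num at hl ⊢
    linarith
  · rw [Real.sqrt_le_left (by norm_num), cFour, h1]
    norm_num at hu ⊢
    linarith

omit [IsProbabilityMeasure μ] in
lemma conv_eq_map :
    μ ∗ _root_.stdGaussian d =
      (μ.prod (ProbabilityTheory.stdGaussian (EuclideanSpace ℝ (Fin d)))).map
        (fun q => q.1 + q.2) := by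
  rw [stdGaussian_eq_stdGaussian]; rfl

omit [IsProbabilityMeasure μ] in
lemma eLpNorm_comp_fst {f : EuclideanSpace ℝ (Fin d) → EuclideanSpace ℝ (Fin d)}
    (hf : Measurable f) (p : ℝ≥0∞) :
    eLpNorm (fun q => f q.1)
      p (μ.prod (ProbabilityTheory.stdGaussian (EuclideanSpace ℝ (Fin d)))) = eLpNorm f p μ :=
  eLpNorm_comp_measurePreserving hf.aestronglyMeasurable measurePreserving_fst

/-- The coupling of `X + Z` with `Z`. -/
lemma Wp_conv_stdGaussian_le_sqrt (hmom : Integrable (fun x => ‖x‖ ^ 2) μ) {p : ℝ≥0} (hp0 : p ≠ 0)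
    (hp2 : p ≤ 2) :
    Wp p (μ ∗ _root_.stdGaussian d) (_root_.stdGaussian d) ≤
      ENNReal.ofReal (√(∫ x, ‖x‖ ^ 2 ∂μ)) := by
  have h := Wp_map_le_eLpNorm
    (P := μ.prod (ProbabilityTheory.stdGaussian (EuclideanSpace ℝ (Fin d))))
    (U := fun q => q.1 + q.2) (V := Prod.snd) (by fun_prop) measurable_snd hp0
  rw [← conv_eq_map, measurePreserving_snd.map_eq, ← stdGaussian_eq_stdGaussian] at h
  refine h.trans ?_
  simp only [add_sub_cancel_right]
  rw [stdGaussian_eq_stdGaussian, eLpNorm_comp_fst (f := fun x => x) measurable_id]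
  exact (eLpNorm_le_eLpNorm_two measurable_id.aestronglyMeasurable hp2).trans
    (eLpNorm_two_le_ofReal_sqrt (lintegral_enorm_sq_eq hmom).le)

/-- The coupling obtained by first replacing `X` with its centred truncation. -/
lemma Wp_conv_stdGaussian_le_add (hmean : ∫ x, x ∂μ = 0) (hmom : Integrable (fun x => ‖x‖ ^ 2) μ)
    (hsmall : ∫ x, ‖x‖ ^ 2 ∂μ ≤ 0.05) {p : ℝ≥0} (hp1 : 1 ≤ p) (hp2 : p ≤ 2) :
    Wp p (μ ∗ _root_.stdGaussian d) (_root_.stdGaussian d) ≤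
      eLpNorm (fun x => x - truncCentred μ x) p μ +
        ENNReal.ofReal (√(2 * cFour) * ∫ x, ‖x‖ ^ 2 ∂μ) := by
  set γ := ProbabilityTheory.stdGaussian (EuclideanSpace ℝ (Fin d)) with hγ
  set a := ∫ x, ‖x‖ ^ 2 ∂μ with ha
  have ha0 : 0 ≤ a := integral_nonneg fun x => by positivity
  set T := truncCentred μ with hT
  have hTm : Measurable T := measurable_truncCentred
  have : IsProbabilityMeasure (μ.map T) := Measure.isProbabilityMeasure_map hTm.aemeasurable
  have hR : ∀ᵐ x ∂(μ.map T), ‖x‖ ≤ (1.05 : ℝ≥0) := by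
    rw [ae_map_iff hTm.aemeasurable (measurableSet_le measurable_norm measurable_const)]
    refine ae_of_all _ fun x => (norm_truncCentred_le hmean hmom x).trans ?_
    push_cast
    linarith
  have hmean' : ∫ x, x ∂(μ.map T) = 0 := by
    rw [integral_map (f := fun x => x) hTm.aemeasurable (by fun_prop)]
    exact integral_truncCentred
  set b := ∫ x, ‖x‖ ^ 2 ∂(μ.map T) with hb
  have hba : b ≤ a := by
    rw [hb, integral_map hTm.aemeasurable (by fun_prop)]
    exact integral_norm_truncCentred_sq_le hmom
  have hb0 : 0 ≤ b := integral_nonneg fun x => by positivity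
  obtain ⟨Φ, hΦ, hlaw, hcost⟩ := exists_transport_to_stdGaussian hR hmean' (by linarith)
  have hmap : (μ.map T).prod γ = (μ.prod γ).map (fun q => (T q.1, q.2)) := by
    have := Measure.map_prod_map μ γ hTm measurable_id
    rwa [Measure.map_id] at this
  have hTm2 : Measurable fun q : EuclideanSpace ℝ (Fin d) × EuclideanSpace ℝ (Fin d) =>
    (T q.1, q.2) := by fun_prop
  rw [← hγ, hmap, Measure.map_map (by fun_prop) hTm2] at hlaw
  rw [← hγ, hmap, lintegral_map (by fun_prop) hTm2] at hcost
  have h := Wp_map_le_eLpNorm (P := μ.prod γ) (U := fun q => q.1 + q.2)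
    (V := fun q => Φ (T q.1 + q.2)) (by fun_prop) (by fun_prop) (p := p)
    (by positivity)
  have hV : (μ.prod γ).map (fun q => Φ (T q.1 + q.2)) = γ := hlaw
  rw [← conv_eq_map, hV] at h
  rw [stdGaussian_eq_stdGaussian] at h ⊢
  refine h.trans ?_
  have hsum : (fun q : EuclideanSpace ℝ (Fin d) × EuclideanSpace ℝ (Fin d) =>
      q.1 + q.2 - Φ (T q.1 + q.2)) =
      (fun q => q.1 - T q.1) + fun q => T q.1 + q.2 - Φ (T q.1 + q.2) := by
    ext1 q; simp only [Pi.add_apply]; abel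
  have hm1 : Measurable fun q : EuclideanSpace ℝ (Fin d) × EuclideanSpace ℝ (Fin d) =>
      q.1 - T q.1 := by fun_prop
  have hm2 : Measurable fun q : EuclideanSpace ℝ (Fin d) × EuclideanSpace ℝ (Fin d) =>
      T q.1 + q.2 - Φ (T q.1 + q.2) := by fun_prop
  rw [hsum]
  refine (eLpNorm_add_le hm1.aestronglyMeasurable hm2.aestronglyMeasurable
    (by exact_mod_cast hp1)).trans (add_le_add ?_ ?_)
  · exact (eLpNorm_comp_fst (f := fun x => x - T x) (measurable_id.sub hTm) p).le
  · refine (eLpNorm_le_eLpNorm_two hm2.aestronglyMeasurable hp2).trans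
      ((eLpNorm_two_le_ofReal_sqrt hcost).trans (ENNReal.ofReal_le_ofReal ?_))
    rw [Real.sqrt_le_left (mul_nonneg (Real.sqrt_nonneg _) ha0), mul_pow]
    have hexp : rexp (((1.05 : ℝ≥0) : ℝ) ^ 2) ≤ 4.5 := by
      have h1 : rexp (((1.05 : ℝ≥0) : ℝ) ^ 2) ≤ rexp (3 / 2) := by
        refine Real.exp_le_exp.2 ?_
        push_cast
        norm_num
      have h3 : rexp (3 / 2) ^ 2 = rexp 1 ^ 3 := by
        rw [← Real.exp_nat_mul, ← Real.exp_nat_mul]; norm_num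
      have hu : rexp 1 ^ 3 ≤ (2.719 : ℝ) ^ 3 :=
        pow_le_pow_left₀ (Real.exp_nonneg _) (by linarith [Real.exp_one_lt_d9]) 3
      refine h1.trans (le_of_sq_le_sq ?_ (by norm_num))
      rw [h3]
      refine hu.trans ?_
      norm_num
    have hs := pow_le_pow_left₀ (by norm_num) sqrt_two_mul_cFour_bounds.1 2
    have hbb : b ^ 2 ≤ a ^ 2 := pow_le_pow_left₀ hb0 hba 2
    rw [div_le_iff₀ (by linarith)]
    calc rexp (((1.05 : ℝ≥0) : ℝ) ^ 2) * b ^ 2 ≤ 4.5 * a ^ 2 := by gcongr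
      _ ≤ 2.475 ^ 2 * a ^ 2 * 0.975 := by nlinarith [sq_nonneg a]
      _ ≤ √(2 * cFour) ^ 2 * a ^ 2 * (1 - b / 2) := by
          gcongr
          linarith

lemma sqrt_le_mul_of_le {a : ℝ} (ha : 0.05 ≤ a) : √a ≤ (2 + √(2 * cFour)) * a := by
  have h := sqrt_two_mul_cFour_bounds.1
  have h2 : √a ≤ 4.475 * a := by
    rw [Real.sqrt_le_left (by positivity)]
    nlinarith
  nlinarith

end Main

/-- moment-only Gaussian convolution bounds. -/
theorem wasserstein_gaussian_convolution_moment
    (d : ℕ) (μ : Measure (EuclideanSpace ℝ (Fin d))) [IsProbabilityMeasure μ]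
    (hmean : ∫ x, x ∂μ = 0)
    (hmom : Integrable (fun x => ‖x‖ ^ 2) μ) :
    (Wp 1 (μ ∗ stdGaussian d) (stdGaussian d) ≤
        ENNReal.ofReal ((2 + Real.sqrt (2 * cFour)) * ∫ x, ‖x‖ ^ 2 ∂μ) ∧
      (2 + Real.sqrt (2 * cFour)) * ∫ x, ‖x‖ ^ 2 ∂μ ≤ 5 * ∫ x, ‖x‖ ^ 2 ∂μ) ∧
    (Integrable (fun x => ‖x‖ ^ 4) μ →
      Wp 2 (μ ∗ stdGaussian d) (stdGaussian d) ≤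
          ENNReal.ofReal ((2 + Real.sqrt (2 * cFour)) * Real.sqrt (∫ x, ‖x‖ ^ 4 ∂μ)) ∧
        (2 + Real.sqrt (2 * cFour)) * Real.sqrt (∫ x, ‖x‖ ^ 4 ∂μ) ≤
          5 * Real.sqrt (∫ x, ‖x‖ ^ 4 ∂μ)) := by
  have hC : 2 + √(2 * cFour) ≤ 5 := by linarith [sqrt_two_mul_cFour_bounds.2]
  have ha0 : 0 ≤ ∫ x, ‖x‖ ^ 2 ∂μ := integral_nonneg fun x => by positivity
  have hs0 := Real.sqrt_nonneg (2 * cFour)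
  refine ⟨⟨?_, mul_le_mul_of_nonneg_right hC ha0⟩, fun hmom4 =>
    ⟨?_, mul_le_mul_of_nonneg_right hC (Real.sqrt_nonneg _)⟩⟩
  · rcases le_total 0.05 (∫ x, ‖x‖ ^ 2 ∂μ) with h | h
    · have := Wp_conv_stdGaussian_le_sqrt hmom one_ne_zero one_le_two
      rw [NNReal.coe_one] at this
      exact this.trans (ENNReal.ofReal_le_ofReal (sqrt_le_mul_of_le h))
    · have := Wp_conv_stdGaussian_le_add hmean hmom h le_rfl one_le_two
      rw [NNReal.coe_one, ENNReal.coe_one] at this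
      refine this.trans ((add_le_add_left (eLpNorm_one_sub_truncCentred_le hmean hmom) _).trans ?_)
      rw [← ENNReal.ofReal_add (by positivity) (by positivity), ← add_mul]
  · have hab : ∫ x, ‖x‖ ^ 2 ∂μ ≤ √(∫ x, ‖x‖ ^ 4 ∂μ) :=
      Real.le_sqrt_of_sq_le (sq_integral_norm_sq_le hmom hmom4)
    rcases le_total 0.05 (∫ x, ‖x‖ ^ 2 ∂μ) with h | h
    · have := Wp_conv_stdGaussian_le_sqrt hmom two_ne_zero le_rfl
      rw [NNReal.coe_ofNat] at this
      refine this.trans (ENNReal.ofReal_le_ofReal ((sqrt_le_mul_of_le h).trans ?_))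
      gcongr
    · have := Wp_conv_stdGaussian_le_add hmean hmom h one_le_two le_rfl
      rw [NNReal.coe_ofNat, ENNReal.coe_ofNat] at this
      refine this.trans
        ((add_le_add_left (eLpNorm_two_sub_truncCentred_le hmean hmom hmom4) _).trans ?_)
      rw [← ENNReal.ofReal_add (by positivity) (by positivity), add_mul]
      refine ENNReal.ofReal_le_ofReal ?_
      gcongr

end
end

section
/- Let X ∼ μ be a Borel probability measure on ℝ^d with E[X] = 0 and E‖X‖² < ∞. Set X̃ = X·1_{‖X‖≤1} − E[X·1_{‖X‖≤1}], Σ̃ = Cov(X̃), and let ν̃ be the law of Z + X̃ for Z ∼ γ independent of X. Then, with c₄ = (e⁴ − 5)/16, KL(ν̃ ‖ γ) ≤ log(1 + χ²(ν̃ ‖ γ)) ≤ log(1 + c₄ ‖Σ̃‖_F²). -/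
open MeasureTheory ProbabilityTheory Real ENNReal RealInnerProductSpace

noncomputable section

namespace ChiSquare

section Divergence

variable {E : Type*} [MeasurableSpace E] {ρ γ : Measure E}

lemma integrable_rnDeriv_toReal (h : ∫⁻ x, ρ.rnDeriv γ x ∂ρ ≠ ∞) :
    Integrable (fun x => (ρ.rnDeriv γ x).toReal) ρ :=
  integrable_toReal_of_lintegral_ne_top (Measure.measurable_rnDeriv ρ γ).aemeasurable h

lemma chiSqDiv_nonneg : 0 ≤ chiSqDiv ρ γ :=
  integral_nonneg fun _ => sq_nonneg _

variable [IsProbabilityMeasure ρ] [IsProbabilityMeasure γ]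

lemma one_add_chiSqDiv (h : ∫⁻ x, ρ.rnDeriv γ x ∂ρ ≠ ∞) (hac : ρ ≪ γ) :
    1 + chiSqDiv ρ γ = ∫ x, (ρ.rnDeriv γ x).toReal ∂ρ := by
  have hi := integrable_rnDeriv_toReal h
  have hsq : Integrable (fun x => (ρ.rnDeriv γ x).toReal * (ρ.rnDeriv γ x).toReal) γ :=
    (integrable_rnDeriv_smul_iff hac).2 hi
  have h1 : Integrable (fun x => (ρ.rnDeriv γ x).toReal) γ := Measure.integrable_toReal_rnDeriv
  have hone : ∫ x, (ρ.rnDeriv γ x).toReal ∂γ = 1 := by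
    simp [Measure.integral_toReal_rnDeriv hac]
  have hexp : ∀ x, ((ρ.rnDeriv γ x).toReal - 1) ^ 2 =
      (ρ.rnDeriv γ x).toReal * (ρ.rnDeriv γ x).toReal - 2 * (ρ.rnDeriv γ x).toReal + 1 :=
    fun x => by ring
  rw [chiSqDiv, ← integral_toReal_rnDeriv_mul hac]
  simp_rw [hexp]
  have hsub : Integrable (fun x => (ρ.rnDeriv γ x).toReal * (ρ.rnDeriv γ x).toReal -
      2 * (ρ.rnDeriv γ x).toReal) γ := hsq.sub (h1.const_mul 2)
  rw [integral_add hsub (integrable_const 1), integral_sub hsq (h1.const_mul 2), integral_const_mul, hone]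
  simp
  ring

lemma klDivReal_le_log_one_add_chiSqDiv (h : ∫⁻ x, ρ.rnDeriv γ x ∂ρ ≠ ∞) (hac : ρ ≪ γ) :
    klDivReal ρ γ ≤ Real.log (1 + chiSqDiv ρ γ) := by
  have hχ : 0 ≤ chiSqDiv ρ γ := chiSqDiv_nonneg
  by_cases hlog : Integrable (fun x => Real.log ((ρ.rnDeriv γ x).toReal)) ρ
  swap
  · rw [klDivReal, integral_undef hlog]
    exact Real.log_nonneg (by linarith)
  have hC := one_add_chiSqDiv h hac
  have hi := integrable_rnDeriv_toReal h
  set C := 1 + chiSqDiv ρ γ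
  have hCpos : 0 < C := by positivity
  have hsub : Integrable (fun x => C⁻¹ * (ρ.rnDeriv γ x).toReal - 1) ρ :=
    (hi.const_mul _).sub (integrable_const _)
  have hle : klDivReal ρ γ ≤ ∫ x, (Real.log C + (C⁻¹ * (ρ.rnDeriv γ x).toReal - 1)) ∂ρ := by
    refine integral_mono_ae hlog ((integrable_const _).add hsub) ?_
    filter_upwards [Measure.rnDeriv_pos hac, hac.ae_le (Measure.rnDeriv_lt_top ρ γ)] with x h0 h1
    have hpos : 0 < (ρ.rnDeriv γ x).toReal := ENNReal.toReal_pos h0.ne' h1.ne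
    have := Real.log_le_sub_one_of_pos (mul_pos (inv_pos.2 hCpos) hpos)
    rw [Real.log_mul (inv_pos.2 hCpos).ne' hpos.ne', Real.log_inv] at this
    linarith
  rw [integral_add (integrable_const _) hsub,
    integral_sub (hi.const_mul _) (integrable_const _), integral_const_mul, ← hC] at hle
  simpa [hCpos.ne'] using hle

end Divergence

section Exponential

/-- The function `(exp t - 1 - t) / t ^ 2` is bounded on `[-4, 4]` by its value at `4`. -/
lemma exp_le_one_add_add_cFour_mul_sq {t : ℝ} (ht : |t| ≤ 4) :
    Real.exp t ≤ 1 + t + cFour * t ^ 2 := by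
  have hs (u : ℝ) : HasSum (fun n : ℕ => u ^ (n + 2) / (n + 2).factorial)
      (Real.exp u - (1 + u)) := by
    have h := NormedSpace.expSeries_div_hasSum_exp u
    rw [← Real.exp_eq_exp_ℝ] at h
    simpa [Finset.sum_range_succ] using (hasSum_nat_add_iff' 2).2 h
  have h4 := (hs 4).mul_left (t ^ 2 / 16)
  have hle := hasSum_le (fun n => ?_) (hs t) h4
  · rw [cFour]
    linarith
  · have hpow : t ^ n ≤ 4 ^ n :=
      (le_abs_self _).trans ((abs_pow t n).le.trans (pow_le_pow_left₀ (abs_nonneg t) ht n))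
    calc t ^ (n + 2) / (n + 2).factorial = t ^ 2 * t ^ n / (n + 2).factorial := by ring
      _ ≤ t ^ 2 * 4 ^ n / (n + 2).factorial := by gcongr
      _ = t ^ 2 / 16 * (4 ^ (n + 2) / (n + 2).factorial) := by ring

end Exponential

section GaussianShift

lemma gaussianReal_eq_withDensity (m : ℝ) :
    gaussianReal m 1 = (gaussianReal 0 1).withDensity
      fun y => ENNReal.ofReal (Real.exp (m * y - m ^ 2 / 2)) := by
  rw [gaussianReal_of_var_ne_zero m one_ne_zero, gaussianReal_of_var_ne_zero 0 one_ne_zero,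
    ← withDensity_mul _ (measurable_gaussianPDF 0 1) (by fun_prop)]
  congr 1
  ext y
  simp only [Pi.mul_apply, gaussianPDF, gaussianPDFReal]
  rw [← ENNReal.ofReal_mul (by positivity), mul_assoc (√_)⁻¹, ← Real.exp_add]
  congr 3
  simp
  ring

lemma pi_gaussianReal_eq_withDensity {ι : Type*} [Fintype ι] (m : ι → ℝ) :
    Measure.pi (fun i => gaussianReal (m i) 1) =
      (Measure.pi fun _ : ι => gaussianReal 0 1).withDensity
        fun y => ∏ i, ENNReal.ofReal (Real.exp (m i * y i - m i ^ 2 / 2)) := by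
  refine Measure.pi_eq fun s hs => ?_
  let g : ι → ℝ → ℝ≥0∞ := fun i =>
    (s i).indicator fun y => ENNReal.ofReal (Real.exp (m i * y - m i ^ 2 / 2))
  have hg (i : ι) : Measurable (g i) := Measurable.indicator (by fun_prop) (hs i)
  have hset : MeasurableSet (Set.univ.pi s) := MeasurableSet.univ_pi hs
  have hind : (Set.univ.pi s).indicator
      (fun y => ∏ i, ENNReal.ofReal (Real.exp (m i * y i - m i ^ 2 / 2))) =
        fun y => ∏ i, g i (y i) := by
    ext y
    by_cases hy : y ∈ Set.univ.pi s
    · rw [Set.indicator_of_mem hy]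
      exact Finset.prod_congr rfl fun i _ => by simp [g, hy i trivial]
    · rw [Set.indicator_of_notMem hy]
      obtain ⟨i, hi⟩ : ∃ i, y i ∉ s i := by simpa [Set.mem_pi] using hy
      exact (Finset.prod_eq_zero (Finset.mem_univ i) (Set.indicator_of_notMem hi _)).symm
  rw [withDensity_apply _ hset, ← lintegral_indicator hset, hind]
  refine (lintegral_prod_eq_prod_lintegral_of_indepFun Finset.univ
    (fun i (y : ι → ℝ) => g i (y i)) (iIndepFun_pi fun i => (hg i).aemeasurable)
    fun i => (hg i).comp (measurable_pi_apply i)).trans ?_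
  refine Finset.prod_congr rfl fun i _ => ?_
  rw [gaussianReal_eq_withDensity (m i), withDensity_apply _ (hs i),
    ← lintegral_indicator (hs i)]
  exact (measurePreserving_eval (fun _ : ι => gaussianReal 0 1) i).lintegral_comp (hg i)

variable {d : ℕ}

/-- The density of `N(x, I_d)` with respect to `N(0, I_d)`. -/
def shiftDensity (x y : EuclideanSpace ℝ (Fin d)) : ℝ≥0∞ :=
  ENNReal.ofReal (Real.exp (⟪x, y⟫ - ‖x‖ ^ 2 / 2))

@[fun_prop]
lemma measurable_shiftDensity {α : Type*} [MeasurableSpace α]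
    {f g : α → EuclideanSpace ℝ (Fin d)} (hf : Measurable f) (hg : Measurable g) :
    Measurable fun a => shiftDensity (f a) (g a) := by
  unfold shiftDensity
  fun_prop

instance : IsProbabilityMeasure (_root_.stdGaussian d) :=
  Measure.isProbabilityMeasure_map (by fun_prop)

lemma lintegral_comp_add_stdGaussian (x : EuclideanSpace ℝ (Fin d))
    {g : EuclideanSpace ℝ (Fin d) → ℝ≥0∞} (hg : Measurable g) :
    ∫⁻ y, g (x + y) ∂(_root_.stdGaussian d) =
      ∫⁻ y, shiftDensity x y * g y ∂(_root_.stdGaussian d) := by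
  have he : Measurable ((EuclideanSpace.equiv (Fin d) ℝ).symm :
      (Fin d → ℝ) → EuclideanSpace ℝ (Fin d)) := by fun_prop
  have hmap : (Measure.pi fun _ : Fin d => gaussianReal 0 1).map (fun y i => x i + y i) =
      Measure.pi fun i => gaussianReal (x i) 1 := by
    rw [Measure.pi_map_pi (f := fun i (t : ℝ) => x i + t) fun i => by fun_prop]
    simp [gaussianReal_map_const_add]
  rw [_root_.stdGaussian, lintegral_map (by fun_prop) he, lintegral_map (by fun_prop) he]
  have hleft : ∀ y : Fin d → ℝ, x + (EuclideanSpace.equiv (Fin d) ℝ).symm y =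
      (EuclideanSpace.equiv (Fin d) ℝ).symm (fun i => x i + y i) := fun y => by ext i; simp
  simp_rw [hleft]
  have htrans := lintegral_map (μ := Measure.pi fun _ : Fin d => gaussianReal 0 1)
    (f := fun y => g ((EuclideanSpace.equiv (Fin d) ℝ).symm y))
    (g := fun y i => x i + y i) (by fun_prop) (by fun_prop)
  rw [← htrans, hmap, pi_gaussianReal_eq_withDensity,
    lintegral_withDensity_eq_lintegral_mul _ (by fun_prop) (by fun_prop)]
  refine lintegral_congr fun y => ?_
  simp only [Pi.mul_apply]
  congr 1
  rw [shiftDensity, ← ENNReal.ofReal_prod_of_nonneg fun i _ => (Real.exp_pos _).le,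
    ← Real.exp_sum, Finset.sum_sub_distrib, EuclideanSpace.norm_sq_eq, Finset.sum_div]
  simp [PiLp.inner_apply, mul_comm]

lemma lintegral_shiftDensity (x : EuclideanSpace ℝ (Fin d)) :
    ∫⁻ y, shiftDensity x y ∂(_root_.stdGaussian d) = 1 := by
  simpa using (lintegral_comp_add_stdGaussian x (g := fun _ => 1) measurable_const).symm

lemma shiftDensity_add_right (x x' y : EuclideanSpace ℝ (Fin d)) :
    shiftDensity x' (x + y) = ENNReal.ofReal (Real.exp ⟪x, x'⟫) * shiftDensity x' y := by
  rw [shiftDensity, shiftDensity, ← ENNReal.ofReal_mul (Real.exp_pos _).le, ← Real.exp_add,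
    inner_add_right, real_inner_comm]
  congr 2
  ring

variable (ν : Measure (EuclideanSpace ℝ (Fin d))) [IsProbabilityMeasure ν]

lemma measurable_mixtureDensity : Measurable fun y => ∫⁻ x, shiftDensity x y ∂ν :=
  Measurable.lintegral_prod_left' (measurable_shiftDensity measurable_fst measurable_snd)

lemma conv_stdGaussian_eq_withDensity :
    ν ∗ _root_.stdGaussian d =
      (_root_.stdGaussian d).withDensity fun y => ∫⁻ x, shiftDensity x y ∂ν := by
  refine Measure.ext_of_lintegral _ fun g hg => ?_
  rw [Measure.lintegral_conv hg,
    lintegral_withDensity_eq_lintegral_mul _ (measurable_mixtureDensity ν) hg]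
  simp_rw [lintegral_comp_add_stdGaussian _ hg]
  have hm : Measurable fun p : EuclideanSpace ℝ (Fin d) × EuclideanSpace ℝ (Fin d) =>
      shiftDensity p.1 p.2 * g p.2 := by fun_prop
  rw [lintegral_lintegral_swap hm.aemeasurable]
  refine lintegral_congr fun y => ?_
  rw [Pi.mul_apply, lintegral_mul_const _ (by fun_prop)]

lemma conv_stdGaussian_absolutelyContinuous :
    ν ∗ _root_.stdGaussian d ≪ _root_.stdGaussian d := by
  rw [conv_stdGaussian_eq_withDensity]
  exact withDensity_absolutelyContinuous _ _

lemma lintegral_rnDeriv_conv_stdGaussian :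
    ∫⁻ y, (ν ∗ _root_.stdGaussian d).rnDeriv (_root_.stdGaussian d) y
        ∂(ν ∗ _root_.stdGaussian d) =
      ∫⁻ p, ENNReal.ofReal (Real.exp ⟪p.1, p.2⟫) ∂(ν.prod ν) := by
  have hrn : (ν ∗ _root_.stdGaussian d).rnDeriv (_root_.stdGaussian d)
      =ᵐ[_root_.stdGaussian d] fun y => ∫⁻ x, shiftDensity x y ∂ν := by
    conv_lhs => rw [conv_stdGaussian_eq_withDensity]
    exact Measure.rnDeriv_withDensity _ (measurable_mixtureDensity ν)
  rw [lintegral_congr_ae ((conv_stdGaussian_absolutelyContinuous ν).ae_le hrn),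
    Measure.lintegral_conv (measurable_mixtureDensity ν), lintegral_prod _ (by fun_prop)]
  refine lintegral_congr fun x => ?_
  have hm : Measurable fun p : EuclideanSpace ℝ (Fin d) × EuclideanSpace ℝ (Fin d) =>
      shiftDensity p.2 (x + p.1) := by fun_prop
  rw [lintegral_lintegral_swap hm.aemeasurable]
  refine lintegral_congr fun x' => ?_
  simp_rw [shiftDensity_add_right]
  rw [lintegral_const_mul _ (by fun_prop),
    lintegral_shiftDensity, mul_one]

end GaussianShift

section BoundedMixture

variable {d : ℕ} (ν : Measure (EuclideanSpace ℝ (Fin d)))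

lemma ae_prod_abs_inner_le [SFinite ν] {r : ℝ} (hr : 0 ≤ r) (hν : ∀ᵐ x ∂ν, ‖x‖ ≤ r) :
    ∀ᵐ p ∂(ν.prod ν), |⟪p.1, p.2⟫| ≤ r * r := by
  filter_upwards [Measure.quasiMeasurePreserving_fst.ae hν,
    Measure.quasiMeasurePreserving_snd.ae hν] with p h1 h2
  exact (abs_real_inner_le_norm _ _).trans (mul_le_mul h1 h2 (norm_nonneg _) hr)

variable [IsProbabilityMeasure ν]

lemma integral_prod_inner_eq_zero (hν : Integrable (fun x => x) ν) (h0 : ∫ x, x ∂ν = 0) :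
    ∫ p, ⟪p.1, p.2⟫ ∂(ν.prod ν) = 0 := by
  by_cases hi : Integrable (fun p : EuclideanSpace ℝ (Fin d) × EuclideanSpace ℝ (Fin d) =>
      ⟪p.1, p.2⟫) (ν.prod ν)
  · rw [integral_prod _ hi]
    simp [integral_inner hν, h0]
  · exact integral_undef hi

lemma integral_prod_inner_sq {r : ℝ} (hν : ∀ᵐ x ∂ν, ‖x‖ ≤ r) :
    ∫ p, ⟪p.1, p.2⟫ ^ 2 ∂(ν.prod ν) = frob (covMat ν) ^ 2 := by
  have hcoord (i j : Fin d) :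
      Integrable (fun x : EuclideanSpace ℝ (Fin d) => x i * x j) ν := by
    refine Integrable.of_bound (by fun_prop) (r * r) ?_
    filter_upwards [hν] with x hx
    rw [norm_mul]
    exact mul_le_mul ((PiLp.norm_apply_le x i).trans hx) ((PiLp.norm_apply_le x j).trans hx)
      (norm_nonneg _) ((norm_nonneg _).trans hx)
  have hexp (p : EuclideanSpace ℝ (Fin d) × EuclideanSpace ℝ (Fin d)) :
      ⟪p.1, p.2⟫ ^ 2 = ∑ i, ∑ j, (p.1 i * p.1 j) * (p.2 i * p.2 j) := by
    rw [PiLp.inner_apply, sq, Finset.sum_mul_sum]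
    refine Finset.sum_congr rfl fun i _ => Finset.sum_congr rfl fun j _ => ?_
    simp
    ring
  have hint (i j : Fin d) := (hcoord i j).mul_prod (hcoord i j)
  simp_rw [hexp]
  rw [frob, Real.sq_sqrt (by positivity),
    integral_finsetSum _ fun i _ => integrable_finsetSum _ fun j _ => hint i j]
  refine Finset.sum_congr rfl fun i _ => ?_
  rw [integral_finsetSum _ fun j _ => hint i j]
  refine Finset.sum_congr rfl fun j _ => ?_
  rw [integral_prod_mul (fun x : EuclideanSpace ℝ (Fin d) => x i * x j)
    (fun x : EuclideanSpace ℝ (Fin d) => x i * x j), covMat, Matrix.of_apply, sq]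

lemma integrable_prod_exp_inner {r : ℝ} (hr : 0 ≤ r) (hν : ∀ᵐ x ∂ν, ‖x‖ ≤ r) :
    Integrable (fun p => Real.exp ⟪p.1, p.2⟫) (ν.prod ν) := by
  refine Integrable.of_bound (by fun_prop) (Real.exp (r * r)) ?_
  filter_upwards [ae_prod_abs_inner_le ν hr hν] with p hp
  rw [Real.norm_eq_abs, Real.abs_exp]
  exact Real.exp_le_exp.2 ((le_abs_self _).trans hp)

lemma integral_prod_exp_inner_le (hν : ∀ᵐ x ∂ν, ‖x‖ ≤ 2) (h0 : ∫ x, x ∂ν = 0) :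
    ∫ p, Real.exp ⟪p.1, p.2⟫ ∂(ν.prod ν) ≤ 1 + cFour * frob (covMat ν) ^ 2 := by
  have hae := ae_prod_abs_inner_le ν zero_le_two hν
  have hid : Integrable (fun x => x) ν := Integrable.of_bound (by fun_prop) 2 hν
  have h1 : Integrable (fun p : EuclideanSpace ℝ (Fin d) × EuclideanSpace ℝ (Fin d) =>
      1 + ⟪p.1, p.2⟫) (ν.prod ν) :=
    (integrable_const 1).add (Integrable.of_bound (by fun_prop) (2 * 2) hae)
  have h2 : Integrable (fun p : EuclideanSpace ℝ (Fin d) × EuclideanSpace ℝ (Fin d) =>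
      cFour * ⟪p.1, p.2⟫ ^ 2) (ν.prod ν) := by
    refine Integrable.const_mul (Integrable.of_bound (by fun_prop) ((2 * 2) ^ 2) ?_) _
    filter_upwards [hae] with p hp
    rw [norm_pow]
    exact pow_le_pow_left₀ (norm_nonneg _) hp 2
  calc ∫ p, Real.exp ⟪p.1, p.2⟫ ∂(ν.prod ν)
      ≤ ∫ p, (1 + ⟪p.1, p.2⟫ + cFour * ⟪p.1, p.2⟫ ^ 2) ∂(ν.prod ν) := by
        refine integral_mono_ae (integrable_prod_exp_inner ν zero_le_two hν) (h1.add h2) ?_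
        filter_upwards [hae] with p hp
        exact exp_le_one_add_add_cFour_mul_sq (by linarith)
    _ = 1 + cFour * frob (covMat ν) ^ 2 := by
        rw [integral_add h1 h2, integral_add (integrable_const 1)
            (Integrable.of_bound (by fun_prop) (2 * 2) hae),
          integral_prod_inner_eq_zero ν hid h0, integral_const_mul, integral_prod_inner_sq ν hν]
        simp

/-- The Kullback–Leibler and chi-squared bounds for a Gaussian smoothing of a centred measure
supported in the ball of radius `2`. -/
lemma kl_conv_stdGaussian_le (hν : ∀ᵐ x ∂ν, ‖x‖ ≤ 2) (h0 : ∫ x, x ∂ν = 0) :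
    klDivReal (ν ∗ _root_.stdGaussian d) (_root_.stdGaussian d) ≤
        Real.log (1 + chiSqDiv (ν ∗ _root_.stdGaussian d) (_root_.stdGaussian d)) ∧
      Real.log (1 + chiSqDiv (ν ∗ _root_.stdGaussian d) (_root_.stdGaussian d)) ≤
        Real.log (1 + cFour * frob (covMat ν) ^ 2) := by
  have hac := conv_stdGaussian_absolutelyContinuous ν
  have hrn := lintegral_rnDeriv_conv_stdGaussian ν
  have hexp := integrable_prod_exp_inner ν zero_le_two hν
  have hfin : ∫⁻ y, (ν ∗ _root_.stdGaussian d).rnDeriv (_root_.stdGaussian d) y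
      ∂(ν ∗ _root_.stdGaussian d) ≠ ∞ := by
    rw [hrn, ← ofReal_integral_eq_lintegral_ofReal hexp (ae_of_all _ fun _ => (Real.exp_pos _).le)]
    exact ENNReal.ofReal_ne_top
  refine ⟨klDivReal_le_log_one_add_chiSqDiv hfin hac, Real.log_le_log ?_ ?_⟩
  · linarith [chiSqDiv_nonneg (ρ := ν ∗ _root_.stdGaussian d) (γ := _root_.stdGaussian d)]
  · rw [one_add_chiSqDiv hfin hac,
      integral_toReal (Measure.measurable_rnDeriv _ _).aemeasurable
        (hac.ae_le (Measure.rnDeriv_lt_top _ _)), hrn,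
      ← ofReal_integral_eq_lintegral_ofReal hexp (ae_of_all _ fun _ => (Real.exp_pos _).le),
      ENNReal.toReal_ofReal (integral_nonneg fun _ => (Real.exp_pos _).le)]
    exact integral_prod_exp_inner_le ν hν h0

end BoundedMixture

section Truncation

variable {d : ℕ} (μ : Measure (EuclideanSpace ℝ (Fin d)))

lemma measurable_truncCentred : Measurable (truncCentred μ) :=
  (Measurable.ite (measurableSet_le measurable_norm measurable_const) measurable_id
    measurable_const).sub_const _

lemma norm_trunc_le (x : EuclideanSpace ℝ (Fin d)) : ‖if ‖x‖ ≤ 1 then x else 0‖ ≤ 1 := by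
  split_ifs with h
  · exact h
  · simp

lemma truncMean_eq : truncMean μ = ∫ x, (if ‖x‖ ≤ 1 then x else 0) ∂μ := by
  rw [truncMean, ← integral_indicator (measurableSet_le measurable_norm measurable_const)]
  rfl

lemma covMat_map_truncCentred : covMat (μ.map (truncCentred μ)) = truncCov μ := by
  ext i j
  rw [covMat, truncCov, Matrix.of_apply, Matrix.of_apply,
    integral_map (measurable_truncCentred μ).aemeasurable (by fun_prop)]

variable [IsProbabilityMeasure μ]

lemma norm_truncMean_le : ‖truncMean μ‖ ≤ 1 := by
  rw [truncMean_eq]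
  simpa using norm_integral_le_of_norm_le_const (μ := μ) (ae_of_all μ norm_trunc_le)

lemma norm_truncCentred_le (x : EuclideanSpace ℝ (Fin d)) : ‖truncCentred μ x‖ ≤ 2 :=
  (norm_sub_le _ _).trans (by linarith [norm_trunc_le x, norm_truncMean_le μ])

lemma integral_truncCentred : ∫ x, truncCentred μ x ∂μ = 0 := by
  have hm : Measurable fun x : EuclideanSpace ℝ (Fin d) => if ‖x‖ ≤ 1 then x else 0 :=
    Measurable.ite (measurableSet_le measurable_norm measurable_const) measurable_id
      measurable_const
  unfold truncCentred
  rw [integral_sub (Integrable.of_bound hm.aestronglyMeasurable 1 (ae_of_all _ norm_trunc_le))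
    (integrable_const _), ← truncMean_eq]
  simp

end Truncation

end ChiSquare

/-- KL bound via chi-squared and the truncated covariance. -/
theorem kl_truncated_convolution_le
    (d : ℕ) (μ : Measure (EuclideanSpace ℝ (Fin d))) [IsProbabilityMeasure μ]
    (hmean : ∫ x, x ∂μ = 0)
    (hmom : Integrable (fun x => ‖x‖ ^ 2) μ) :
    klDivReal ((μ.map (truncCentred μ)) ∗ stdGaussian d) (stdGaussian d) ≤
        Real.log (1 + chiSqDiv ((μ.map (truncCentred μ)) ∗ stdGaussian d) (stdGaussian d)) ∧
      Real.log (1 + chiSqDiv ((μ.map (truncCentred μ)) ∗ stdGaussian d) (stdGaussian d)) ≤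
        Real.log (1 + cFour * frob (truncCov μ) ^ 2) := by
  have hT := ChiSquare.measurable_truncCentred μ
  have : IsProbabilityMeasure (μ.map (truncCentred μ)) :=
    Measure.isProbabilityMeasure_map hT.aemeasurable
  rw [← ChiSquare.covMat_map_truncCentred]
  refine ChiSquare.kl_conv_stdGaussian_le _ ?_ ?_
  · exact (ae_map_iff hT.aemeasurable (measurableSet_le measurable_norm measurable_const)).2
      (ae_of_all _ (ChiSquare.norm_truncCentred_le μ))
  · rw [integral_map hT.aemeasurable (by fun_prop), ChiSquare.integral_truncCentred]

end
end
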